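/- Let h = 2n+1 be an odd integer with n ≥ 2, let 1 ≤ i < n, let σ be an h-bar-core with exactly one addable i-node and let τ = ψ_i(σ), so that P_{σ,2} and P_{τ,2} form a [2:1]-pair of residue i. Then exactly three partitions of P_{σ,2} are exceptional (i.e. have a removable i-node), and they can be written α ◁ β ◁ γ in the dominance order; exactly three partitions of P_{τ,2} are exceptional (i.e. have an addable i-node), and they can be written α̂ ◁ β̂ ◁ γ̂ in the dominance order. Moreover ψ_i(α) = α̂, ψ_i(β) = γ̂ and ψ_i(γ) = β̂. -/

import Mathlib

/-- A partition: a weakly decreasing sequence of non-negative integers with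
finite sum (finitely many nonzero parts), indexed from 0 (so `parts 0` is λ₁). -/
structure BPartition where
  parts : ℕ →₀ ℕ
  antitone : ∀ r, parts (r + 1) ≤ parts r

namespace BPartition

/-- The multiset of positive parts of a partition. -/
def partsM (lam : BPartition) : Multiset ℕ :=
  lam.parts.support.val.map (fun r => lam.parts r)

/-- The Young diagram: nodes `(r, c)` with rows indexed from 0 and columns from 1. -/
def diagram (lam : BPartition) : Set (ℕ × ℕ) :=
  {x | 1 ≤ x.2 ∧ x.2 ≤ lam.parts x.1}

/-- A partition is strict if λ_r > λ_{r+1} whenever λ_r > 0. -/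
def IsStrict (lam : BPartition) : Prop :=
  ∀ r, 0 < lam.parts r → lam.parts (r + 1) < lam.parts r

/-- A partition is h-strict if each part is either strictly bigger than the next,
or positive and divisible by h, or zero. -/
def IsHStrict (h : ℕ) (lam : BPartition) : Prop :=
  ∀ r, lam.parts (r + 1) < lam.parts r ∨ (0 < lam.parts r ∧ h ∣ lam.parts r) ∨ lam.parts r = 0

/-- An h-strict partition is restricted if for every r either λ_{r+1} > λ_r − h,
or λ_{r+1} = λ_r − h and h does not divide λ_r. -/
def IsRestricted (h : ℕ) (lam : BPartition) : Prop :=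
  ∀ r, lam.parts r < lam.parts (r + 1) + h ∨
    (lam.parts (r + 1) + h = lam.parts r ∧ ¬ h ∣ lam.parts r)

/-- The residue of a node in column c (1-indexed): the smaller of the residues of
c − 1 and of −c modulo h. -/
def colRes (h c : ℕ) : ℕ := min ((c - 1) % h) ((h - c % h) % h)

/-- `x` is an addable i-node of `lam`. -/
def Addable (h i : ℕ) (lam : BPartition) (x : ℕ × ℕ) : Prop :=
  colRes h x.2 = i ∧ x ∉ diagram lam ∧
  ∃ nu : BPartition, IsHStrict h nu ∧ diagram lam ⊆ diagram nu ∧ x ∈ diagram nu ∧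
    ∀ y ∈ diagram nu, y ∉ diagram lam → colRes h y.2 = i

/-- `x` is a removable i-node of `lam`. -/
def Removable (h i : ℕ) (lam : BPartition) (x : ℕ × ℕ) : Prop :=
  x ∈ diagram lam ∧
  ∃ mu : BPartition, IsHStrict h mu ∧ diagram mu ⊆ diagram lam ∧ x ∉ diagram mu ∧
    ∀ y ∈ diagram lam, y ∉ diagram mu → colRes h y.2 = i

/-- Removal of a single h-bar from `lam` giving `mu`, recording the value `v`:
either a part `v ≥ h` is replaced by `v − h` (deleted if `v = h`), or two parts
summing to `h` are deleted, in which case `v` is the larger of the two. -/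
def barStepRec (h : ℕ) (lam mu : BPartition) (v : ℕ) : Prop :=
  IsHStrict h mu ∧
  ((v = h ∧ v ∈ partsM lam ∧ partsM mu = (partsM lam).erase v) ∨
   (h < v ∧ v ∈ partsM lam ∧ partsM mu = (v - h) ::ₘ (partsM lam).erase v) ∨
   (∃ a b : ℕ, a + b = h ∧ a ∈ partsM lam ∧ b ∈ (partsM lam).erase a ∧
      v = max a b ∧ partsM mu = ((partsM lam).erase a).erase b))

/-- Removal of a single h-bar. -/
def barStep (h : ℕ) (lam mu : BPartition) : Prop :=
  ∃ v, barStepRec h lam mu v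

/-- An h-bar-core: an h-strict partition from which no h-bar can be removed. -/
def IsBarCore (h : ℕ) (lam : BPartition) : Prop :=
  IsHStrict h lam ∧ ∀ mu, ¬ barStep h lam mu

/-- A chain of `w` h-bar removals from `lam` down to `mu`. -/
def barChain (h : ℕ) : ℕ → BPartition → BPartition → Prop
  | 0, lam, mu => lam = mu
  | w + 1, lam, mu => ∃ nu, barStep h lam nu ∧ barChain h w nu mu

/-- `lam ∈ P_{τ,w}`: `lam` is h-strict with h-bar-core `tau` and h-bar-weight `w`. -/
def InBlock (h : ℕ) (tau : BPartition) (w : ℕ) (lam : BPartition) : Prop :=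
  IsHStrict h lam ∧ IsBarCore h tau ∧ barChain h w lam tau

/-- The left-to-right order on node positions along the edge of a Young diagram:
smaller column first; within a column, larger row first. -/
def posLE (x y : ℕ × ℕ) : Prop := x.2 < y.2 ∨ (x.2 = y.2 ∧ y.1 ≤ x.1)

/-- `x` is a normal i-node: a removable i-node surviving (as a − sign) in the
reduced i-signature; equivalently, every window of the i-signature ending at `x`
contains strictly more removable than addable i-nodes. -/
def Normal (h i : ℕ) (lam : BPartition) (x : ℕ × ℕ) : Prop :=
  Removable h i lam x ∧ ∀ z : ℕ × ℕ, posLE z x →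
    Set.ncard {y | Addable h i lam y ∧ posLE z y ∧ posLE y x} <
      Set.ncard {y | Removable h i lam y ∧ posLE z y ∧ posLE y x}

/-- `x` is a conormal i-node: an addable i-node surviving (as a + sign) in the
reduced i-signature. -/
def Conormal (h i : ℕ) (lam : BPartition) (x : ℕ × ℕ) : Prop :=
  Addable h i lam x ∧ ∀ z : ℕ × ℕ, posLE x z →
    Set.ncard {y | Removable h i lam y ∧ posLE x y ∧ posLE y z} <
      Set.ncard {y | Addable h i lam y ∧ posLE x y ∧ posLE y z}

/-- The node set of ψ_i(λ): add the leftmost s − r conormal i-nodes if s ≥ r,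
remove the rightmost r − s normal i-nodes if r > s, where r = #normal and
s = #conormal i-nodes. -/
noncomputable def psiSet (h i : ℕ) (lam : BPartition) : Set (ℕ × ℕ) :=
  if Set.ncard {x | Normal h i lam x} ≤ Set.ncard {x | Conormal h i lam x} then
    diagram lam ∪ {x | Conormal h i lam x ∧
      Set.ncard {y | Conormal h i lam y ∧ posLE y x} ≤
        Set.ncard {x | Conormal h i lam x} - Set.ncard {x | Normal h i lam x}}
  else
    diagram lam \ {x | Normal h i lam x ∧
      Set.ncard {y | Normal h i lam y ∧ posLE x y} ≤
        Set.ncard {x | Normal h i lam x} - Set.ncard {x | Conormal h i lam x}}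

open Classical in
/-- The involution ψ_i. -/
noncomputable def psi (h i : ℕ) (lam : BPartition) : BPartition :=
  if hex : ∃ mu : BPartition, diagram mu = psiSet h i lam then hex.choose else lam

/-- The set of occupied positions of the abacus display of a strict partition. -/
def abacus (lam : BPartition) : Set ℤ :=
  {a | a = 0 ∨ (0 < a ∧ a.toNat ∈ partsM lam) ∨ (a < 0 ∧ (-a).toNat ∉ partsM lam)}

/-- The dominance order: λ ⊴ μ. -/
def domLE (lam mu : BPartition) : Prop :=
  ∀ r, ∑ s ∈ Finset.range r, lam.parts s ≤ ∑ s ∈ Finset.range r, mu.parts s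

/-- Strict dominance: λ ◁ μ. -/
def domLT (lam mu : BPartition) : Prop := domLE lam mu ∧ lam ≠ mu

/-- Lexicographic order: λ <lex μ. -/
def lexLT (lam mu : BPartition) : Prop :=
  ∃ r, lam.parts r < mu.parts r ∧ ∀ s < r, lam.parts s = mu.parts s

/-- Colexicographic order: λ <colex μ. -/
def colexLT (lam mu : BPartition) : Prop :=
  ∃ r, mu.parts r < lam.parts r ∧ ∀ s, r < s → lam.parts s = mu.parts s

/-- λ ↔ᵢ μ: every node of the symmetric difference of the diagrams has residue i. -/
def Link (h i : ℕ) (lam mu : BPartition) : Prop :=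
  ∀ x : ℕ × ℕ, x ∈ (diagram lam \ diagram mu) ∪ (diagram mu \ diagram lam) →
    colRes h x.2 = i

/-- `a ≤ b` are the bar positions of `lam ∈ P_{τ,2}`: the values recorded by
some two-step removal of h-bars from `lam` down to `tau`. -/
def BarPositions (h : ℕ) (tau lam : BPartition) (a b : ℕ) : Prop :=
  a ≤ b ∧ ∃ (nu : BPartition) (v₁ v₂ : ℕ), barStepRec h lam nu v₁ ∧ barStepRec h nu tau v₂ ∧
    ({a, b} : Multiset ℕ) = {v₁, v₂}

/-- The leg length of the bar of `lam ∈ P_{τ,2}` at bar position `c`. -/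
noncomputable def legLen (h : ℕ) (tau lam : BPartition) (c : ℕ) : ℕ :=
  if h ≤ c then Set.ncard {x : ℕ | c - h < x ∧ x < c ∧ x ∈ partsM lam ∧ x ∈ partsM tau}
  else (h - c) + Set.ncard {x : ℕ | h - c < x ∧ x < c ∧ x ∈ partsM lam ∧ x ∈ partsM tau}

/-- ∂λ: the absolute difference of the two leg lengths of `lam`, whose bar
positions are `a ≤ b`. -/
noncomputable def ddd (h : ℕ) (tau lam : BPartition) (a b : ℕ) : ℕ :=
  max (legLen h tau lam a) (legLen h tau lam b) - min (legLen h tau lam a) (legLen h tau lam b)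

inductive Colour | black | white | grey
deriving DecidableEq

/-- β(τ): the number of parts of τ less than h. -/
def betaCount (h : ℕ) (tau : BPartition) : ℕ :=
  Multiset.card ((partsM tau).filter (fun x => x < h))

/-- The leg length of a 2h-bar of `lam` with larger bar position `b`. -/
noncomputable def legLen2 (h : ℕ) (tau lam : BPartition) (b : ℕ) : ℕ :=
  if 2 * h ≤ b then Set.ncard {x : ℕ | b - 2 * h < x ∧ x < b ∧ x ∈ partsM lam ∧ x ∈ partsM tau}
  else (2 * h - b) + Set.ncard {x : ℕ | 2 * h - b < x ∧ x < b ∧ x ∈ partsM lam ∧ x ∈ partsM tau}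

/-- The colour of `lam ∈ P_{τ,2}` with bar positions `a ≤ b`. -/
noncomputable def colour (h : ℕ) (tau lam : BPartition) (a b : ℕ) : Colour :=
  if 2 ≤ ddd h tau lam a b then Colour.grey
  else if ddd h tau lam a b = 1 then
    if h < b then Colour.grey
    else if (min (legLen h tau lam a) (legLen h tau lam b) + betaCount h tau) % 2 = 1 then
      Colour.black else Colour.white
  else
    if b = a + h ∨ a + b = 2 * h then
      if (legLen2 h tau lam b + 2 * betaCount h tau) % 4 = 0 ∨
         (legLen2 h tau lam b + 2 * betaCount h tau) % 4 = 3 then Colour.black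
      else Colour.white
    else
      if (legLen h tau lam a + betaCount h tau) % 2 = 1 then Colour.black else Colour.white

end BPartition

namespace BPartition

/-! basics -/

theorem anti {lam : BPartition} {r s : ℕ} (h : r ≤ s) : lam.parts s ≤ lam.parts r :=
  antitone_nat_of_succ_le lam.antitone h

theorem mem_partsM {lam : BPartition} {x : ℕ} :
    x ∈ partsM lam ↔ x ≠ 0 ∧ ∃ r, lam.parts r = x := by
  unfold partsM
  simp only [Multiset.mem_map, Finset.mem_val, Finsupp.mem_support_iff]
  constructor
  · rintro ⟨r, h, rfl⟩; exact ⟨h, r, rfl⟩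
  · rintro ⟨h, r, rfl⟩; exact ⟨r, h, rfl⟩

theorem parts_inj {lam mu : BPartition} (h : lam.parts = mu.parts) : lam = mu := by
  cases lam; cases mu; simp_all

theorem support_eq (lam : BPartition) : ∃ L, lam.parts.support = Finset.range L := by
  have hex : ∃ L, lam.parts L = 0 := by
    obtain ⟨L, hL⟩ := Infinite.exists_notMem_finset lam.parts.support
    exact ⟨L, by simpa using hL⟩
  classical
  refine ⟨Nat.find hex, ?_⟩
  ext r
  simp only [Finsupp.mem_support_iff, Finset.mem_range]
  constructor
  · intro h
    by_contra h2
    have := anti (lam := lam) (not_lt.mp h2)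
    rw [Nat.find_spec hex] at this
    omega
  · intro h; exact Nat.find_min hex h

theorem sort_partsM (lam : BPartition) :
    ∃ L, lam.parts.support = Finset.range L ∧
      (partsM lam).sort (· ≥ ·) = (List.range L).map lam.parts := by
  obtain ⟨L, hL⟩ := support_eq lam
  refine ⟨L, hL, ?_⟩
  have h1 : partsM lam = (((List.range L).map lam.parts : List ℕ) : Multiset ℕ) := by
    unfold partsM
    rw [hL]; rfl
  rw [h1]
  apply List.Perm.eq_of_pairwise (le := (· ≥ ·))
  · intro a b _ _ h1 h2; exact le_antisymm h2 h1
  · exact Multiset.pairwise_sort _ _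
  · rw [List.pairwise_map]
    exact List.pairwise_lt_range.imp (fun h => anti h.le)
  · have := Multiset.sort_eq (↑((List.range L).map lam.parts) : Multiset ℕ) (· ≥ ·)
    exact Multiset.coe_eq_coe.mp this

theorem parts_eq_getD (lam : BPartition) (r : ℕ) :
    lam.parts r = ((partsM lam).sort (· ≥ ·)).getD r 0 := by
  obtain ⟨L, hL, hs⟩ := sort_partsM lam
  rw [hs]
  by_cases hr : r < L
  · simp [List.getD, hr]
  · have : r ∉ lam.parts.support := by rw [hL]; simpa using hr
    simp [List.getD, hr]
    simpa using this

theorem eq_of_partsM {lam mu : BPartition} (h : partsM lam = partsM mu) : lam = mu := by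
  apply parts_inj
  ext r
  rw [parts_eq_getD, parts_eq_getD, h]

theorem exists_of_multiset (s : Multiset ℕ) (hs : 0 ∉ s) : ∃ lam : BPartition, partsM lam = s := by
  set l := s.sort (· ≥ ·) with hl
  have hsort : l.Pairwise (· ≥ ·) := Multiset.pairwise_sort _ _
  have hmem : ∀ x ∈ l, x ≠ 0 := by
    intro x hx h0; subst h0; exact hs (by simpa [hl] using hx)
  have hsup : ∀ r, l.getD r 0 ≠ 0 ↔ r ∈ Finset.range l.length := by
    intro r
    by_cases hr : r < l.length
    · simp [List.getD, hr]
      exact hmem _ (List.getElem_mem hr)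
    · simp [List.getD, hr]
  let f : ℕ →₀ ℕ := ⟨Finset.range l.length, fun r => l.getD r 0, fun r => (hsup r).symm⟩
  have hf : ∀ r, f r = l.getD r 0 := fun r => rfl
  refine ⟨⟨f, ?_⟩, ?_⟩
  · intro r
    rw [hf, hf]
    by_cases hr : r + 1 < l.length
    · have hr' : r < l.length := by omega
      simp only [List.getD, List.getElem?_eq_getElem hr, List.getElem?_eq_getElem hr',
        Option.getD_some]
      exact List.pairwise_iff_getElem.mp hsort r (r+1) hr' hr (by omega)
    · simp [List.getD, hr]
  · unfold partsM
    have h1 : (Finset.range l.length).val.map (fun r => l.getD r 0) = (l : Multiset ℕ) := by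
      change (((List.range l.length).map (fun r => l.getD r 0) : List ℕ) : Multiset ℕ) = l
      congr 1
      apply List.ext_getElem
      · simp
      · intro n h1 h2; simp [List.getD, h2]
    change (Finset.range l.length).val.map (fun r => l.getD r 0) = s
    rw [h1, hl]; exact Multiset.sort_eq _ _

/-- multiplicity of a part -/
def cnt (lam : BPartition) (y : ℕ) : ℕ := (partsM lam).count y

theorem eq_of_cnt {lam mu : BPartition} (h : ∀ y, cnt lam y = cnt mu y) : lam = mu :=
  eq_of_partsM (Multiset.ext.mpr h)

theorem cnt_eq_card (lam : BPartition) (y : ℕ) :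
    cnt lam y = (lam.parts.support.filter (fun r => y = lam.parts r)).card := by
  unfold cnt partsM
  rw [Multiset.count_map]; rfl

theorem cnt_zero (lam : BPartition) : cnt lam 0 = 0 := by
  unfold cnt; rw [Multiset.count_eq_zero, mem_partsM]; simp

theorem mem_iff_cnt {lam : BPartition} {y : ℕ} : y ∈ partsM lam ↔ cnt lam y ≠ 0 := by
  unfold cnt; rw [Ne, Multiset.count_eq_zero, not_not]

theorem hstrict_lt {h : ℕ} {lam : BPartition} (hs : IsHStrict h lam) {r s : ℕ} (hrs : r < s)
    (h2 : ¬ h ∣ lam.parts r) : lam.parts s < lam.parts r := by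
  rcases hs r with h3 | h3 | h3
  · exact lt_of_le_of_lt (anti (by omega)) h3
  · exact absurd h3.2 h2
  · rw [h3] at h2; exact absurd (dvd_zero _) h2

theorem hstrict_iff {h : ℕ} {lam : BPartition} :
    IsHStrict h lam ↔ ∀ y, ¬ h ∣ y → cnt lam y ≤ 1 := by
  constructor
  · intro hs y hy
    rw [cnt_eq_card, Finset.card_le_one]
    intro a ha b hb
    simp only [Finset.mem_filter] at ha hb
    rcases lt_trichotomy a b with h1 | h1 | h1
    · have := hstrict_lt hs h1 (by rw [← ha.2]; exact hy); omega
    · exact h1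
    · have := hstrict_lt hs h1 (by rw [← hb.2]; exact hy); omega
  · intro hy r
    by_contra! hc
    have h1 := le_antisymm (lam.antitone r) hc.1
    have h2 := hy (lam.parts r) (hc.2.1 (by omega))
    rw [cnt_eq_card, Finset.card_le_one] at h2
    have := h2 r (by simp [hc.2.2]) (r+1) (by simp [h1, hc.2.2])
    omega

/-- mu obtained by flipping parts u and v -/
def Flip2 (lam mu : BPartition) (u v : ℕ) : Prop :=
  ∀ y, cnt mu y = if y = u ∨ y = v then 1 - cnt lam y else cnt lam y

theorem exists_of_cnt (lam : BPartition) (f : ℕ → ℕ) (S : Finset ℕ)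
    (h1 : ∀ y, y ∉ S → f y = cnt lam y) (h0 : f 0 = 0) :
    ∃ mu, ∀ y, cnt mu y = f y := by
  classical
  let T := S ∪ (partsM lam).toFinset
  have hT : ∀ y, y ∉ T → f y = 0 := by
    intro y hy
    simp only [T, Finset.mem_union, Multiset.mem_toFinset, not_or] at hy
    rw [h1 y hy.1]; exact Multiset.count_eq_zero.mpr hy.2
  have hc : ∀ y, Multiset.count y (∑ x ∈ T, Multiset.replicate (f x) x) = f y := by
    intro y
    rw [Multiset.count_sum']
    simp only [Multiset.count_replicate]
    by_cases hy : y ∈ T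
    · rw [Finset.sum_eq_single y]
      · simp
      · intro x _ hx; simp [hx]
      · intro h; exact absurd hy h
    · rw [hT y hy]
      apply Finset.sum_eq_zero
      intro x hx
      rw [if_neg]; rintro rfl; exact hy hx
  obtain ⟨mu, hmu⟩ := exists_of_multiset (∑ x ∈ T, Multiset.replicate (f x) x) (by
    rw [← Multiset.count_eq_zero, hc, h0])
  exact ⟨mu, fun y => by unfold cnt; rw [hmu, hc]⟩

theorem exists_flip2 {h : ℕ} {lam : BPartition} (hs : IsHStrict h lam) {u v : ℕ}
    (hu : ¬ h ∣ u) (hv : ¬ h ∣ v) : ∃ mu, IsHStrict h mu ∧ Flip2 lam mu u v := by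
  obtain ⟨mu, hmu⟩ := exists_of_cnt lam
    (fun y => if y = u ∨ y = v then 1 - cnt lam y else cnt lam y) {u, v} (by
      intro y hy; simp at hy; simp [hy]) (by
      have h1 : (0:ℕ) ≠ u := by rintro rfl; simp at hu
      have h2 : (0:ℕ) ≠ v := by rintro rfl; simp at hv
      simp [h1, h2, cnt_zero])
  refine ⟨mu, ?_, hmu⟩
  rw [hstrict_iff] at hs ⊢
  intro y hy
  rw [hmu]
  have := hs y hy
  split_ifs <;> omega

/-! positions -/

/-- occupied positions -/
def occ (lam : BPartition) (x : ℤ) : Prop := (x.natAbs ∈ partsM lam ↔ 0 < x)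

theorem Flip2.mem {lam mu : BPartition} {u v : ℕ} (hf : Flip2 lam mu u v) (y : ℕ) :
    (y ∈ partsM mu ↔ ((y = u ∨ y = v) ∧ y ∉ partsM lam ∨ ¬ (y = u ∨ y = v) ∧ y ∈ partsM lam)) := by
  rw [mem_iff_cnt, mem_iff_cnt, hf y]
  split_ifs with h1
  · simp [h1]; omega
  · simp [h1]

theorem mult_step {h : ℕ} {lam : BPartition} (hs : IsHStrict h lam) {v : ℕ}
    (hv : v ∈ partsM lam) (hd : h ∣ v) : ∃ mu, barStep h lam mu := by
  have hv0 : v ≠ 0 := (mem_partsM.mp hv).1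
  have hvh : h ≤ v := Nat.le_of_dvd (by omega) hd
  rw [hstrict_iff] at hs
  rcases hvh.eq_or_lt with h1 | h1
  · obtain ⟨mu, hmu⟩ := exists_of_multiset ((partsM lam).erase v) (fun h0 => by
      exact (mem_partsM.mp (Multiset.mem_of_mem_erase h0)).1 rfl)
    refine ⟨mu, v, ?_, Or.inl ⟨h1.symm, hv, hmu⟩⟩
    rw [hstrict_iff]
    intro y hy
    unfold cnt; rw [hmu]
    exact (Multiset.count_le_of_le _ (Multiset.erase_le _ _)).trans (hs y hy)
  · obtain ⟨mu, hmu⟩ := exists_of_multiset ((v - h) ::ₘ (partsM lam).erase v) (fun h0 => by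
      rcases Multiset.mem_cons.mp h0 with h2 | h2
      · omega
      · exact (mem_partsM.mp (Multiset.mem_of_mem_erase h2)).1 rfl)
    refine ⟨mu, v, ?_, Or.inr (Or.inl ⟨h1, hv, hmu⟩)⟩
    rw [hstrict_iff]
    intro y hy
    unfold cnt; rw [hmu]
    rw [Multiset.count_cons_of_ne]
    · exact (Multiset.count_le_of_le _ (Multiset.erase_le _ _)).trans (hs y hy)
    · rintro rfl; exact hy (Nat.dvd_sub hd dvd_rfl)

theorem bar_backward {h : ℕ} (hodd : h % 2 = 1) {lam : BPartition} (hs : IsHStrict h lam) {x : ℤ}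
    (hx : ¬ (h : ℤ) ∣ x) (h1 : occ lam x) (h2 : ¬ occ lam (x - h)) :
    ∃ mu, IsHStrict h mu ∧ barStep h lam mu ∧ Flip2 lam mu x.natAbs (x - h).natAbs := by
  have hx' : ¬ (h : ℤ) ∣ x - h := fun hc => hx (by simpa using hc)
  obtain ⟨mu, hmu, hf⟩ := exists_flip2 hs (u := x.natAbs) (v := (x - h).natAbs)
    (by rwa [← Int.natCast_dvd]) (by rwa [← Int.natCast_dvd])
  refine ⟨mu, hmu, ?_, hf⟩
  have hx0 : x ≠ 0 := by rintro rfl; simp at hx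
  have hxh : x ≠ h := by rintro rfl; simp at hx
  unfold occ at h1 h2
  have hsx := hstrict_iff.mp hs x.natAbs (by rwa [← Int.natCast_dvd])
  have hsx' := hstrict_iff.mp hs (x - h).natAbs (by rwa [← Int.natCast_dvd])
  rw [mem_iff_cnt] at h1 h2
  rcases lt_trichotomy x 0 with h3 | h3 | h3
  · -- v = h - x
    have e1 : (x - h).natAbs - h = x.natAbs := by omega
    have c1 : cnt lam (x-h).natAbs = 1 := by omega
    have c2 : cnt lam x.natAbs = 0 := by omega
    refine ⟨(x-h).natAbs, hmu, Or.inr (Or.inl ⟨by omega, mem_iff_cnt.mpr (by omega), ?_⟩)⟩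
    rw [e1]
    have hne : x.natAbs ≠ (x-h).natAbs := by omega
    ext y
    have := hf y
    unfold cnt at this c1 c2
    rw [this]
    by_cases y1 : y = x.natAbs
    · subst y1; simp [c2, hne]
    · by_cases y2 : y = (x-h).natAbs
      · subst y2; simp [c1, hne.symm]
      · simp [y1, y2]
  · omega
  · by_cases h4 : x < h
    · have c1 : cnt lam (x-h).natAbs = 1 := by omega
      have c2 : cnt lam x.natAbs = 1 := by omega
      have hne : x.natAbs ≠ (x-h).natAbs := by omega
      refine ⟨_, hmu, Or.inr (Or.inr ⟨x.natAbs, (x-h).natAbs, by omega,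
        mem_iff_cnt.mpr (by omega), ?_, rfl, ?_⟩)⟩
      · rw [Multiset.mem_erase_of_ne hne.symm]; exact mem_iff_cnt.mpr (by omega)
      ext y
      have := hf y
      unfold cnt at this c1 c2
      rw [this]
      by_cases y1 : y = x.natAbs
      · subst y1; simp [c2, hne]
      · by_cases y2 : y = (x-h).natAbs
        · subst y2; simp [c1, hne.symm]
        · simp [y1, y2]
    · have e1 : x.natAbs - h = (x-h).natAbs := by omega
      have c1 : cnt lam (x-h).natAbs = 0 := by omega
      have c2 : cnt lam x.natAbs = 1 := by omega
      have hne : x.natAbs ≠ (x-h).natAbs := by omega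
      refine ⟨x.natAbs, hmu, Or.inr (Or.inl ⟨by omega, mem_iff_cnt.mpr (by omega), ?_⟩)⟩
      rw [e1]
      ext y
      have := hf y
      unfold cnt at this c1 c2
      rw [this]
      by_cases y1 : y = x.natAbs
      · subst y1; simp [c2, hne]
      · by_cases y2 : y = (x-h).natAbs
        · subst y2; simp [c1, hne.symm]
        · simp [y1, y2]

theorem bar_forward {h : ℕ} (hodd : h % 2 = 1) {lam mu : BPartition} (hs : IsHStrict h lam)
    (hb : barStep h lam mu) :
    ((∃ v ∈ partsM lam, h ∣ v) ∧ ∀ y, ¬ h ∣ y → cnt mu y = cnt lam y) ∨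
    ∃ x : ℤ, ¬ (h : ℤ) ∣ x ∧ occ lam x ∧ ¬ occ lam (x - h) ∧
      Flip2 lam mu x.natAbs (x - h).natAbs := by
  obtain ⟨v, hmu, hb⟩ := hb
  have hmu' := hstrict_iff.mp hmu
  have hs' := hstrict_iff.mp hs
  rcases hb with ⟨h1, h2, h3⟩ | ⟨h1, h2, h3⟩ | ⟨a, b, h1, h2, h3, -, h5⟩
  · left
    refine ⟨⟨v, h2, by rw [h1]⟩, fun y hy => ?_⟩
    unfold cnt; rw [h3, Multiset.count_erase_of_ne]
    rintro rfl; exact hy (by rw [h1])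
  · by_cases hd : h ∣ v
    · left
      refine ⟨⟨v, h2, hd⟩, fun y hy => ?_⟩
      unfold cnt
      rw [h3, Multiset.count_cons_of_ne, Multiset.count_erase_of_ne]
      · rintro rfl; exact hy hd
      · rintro rfl; exact hy (Nat.dvd_sub hd dvd_rfl)
    · right
      have hd2 : ¬ h ∣ v - h := fun hc => hd (by
        have := Nat.dvd_add hc (dvd_refl h); rwa [Nat.sub_add_cancel h1.le] at this)
      have a1 : cnt lam v = 1 := by
        have := hs' v hd; have := mem_iff_cnt.mp h2; omega
      have hne : v - h ≠ v := by omega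
      have a2 : cnt lam (v-h) = 0 := by
        have := hmu' (v-h) hd2
        unfold cnt at this
        rw [h3, Multiset.count_cons_self, Multiset.count_erase_of_ne hne] at this
        unfold cnt; omega
      have e1 : (v:ℤ).natAbs = v := by omega
      have e2 : ((v:ℤ) - h).natAbs = v - h := by omega
      refine ⟨v, by exact_mod_cast hd, ?_, ?_, ?_⟩
      · unfold occ; rw [e1, mem_iff_cnt]; omega
      · unfold occ; rw [e2, mem_iff_cnt]; omega
      · rw [e1, e2]
        intro y
        unfold cnt at a1 a2 ⊢
        rw [h3]
        by_cases y1 : y = v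
        · subst y1; simp [a1, hne.symm]
        · by_cases y2 : y = v - h
          · subst y2; simp [a2, hne]
          · simp [y1, y2]
  · right
    have ha0 := (mem_partsM.mp h2).1
    have hb' := Multiset.mem_of_mem_erase h3
    have hb0 := (mem_partsM.mp hb').1
    have hda : ¬ h ∣ a := fun hc => by have := Nat.le_of_dvd (by omega) hc; omega
    have hdb : ¬ h ∣ b := fun hc => by have := Nat.le_of_dvd (by omega) hc; omega
    have hne : a ≠ b := by omega
    have a1 : cnt lam a = 1 := by
      have := hs' a hda; have := mem_iff_cnt.mp h2; omega
    have a2 : cnt lam b = 1 := by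
      have := hs' b hdb; have := mem_iff_cnt.mp hb'; omega
    have e1 : (a:ℤ).natAbs = a := by omega
    have e2 : ((a:ℤ) - h).natAbs = b := by omega
    refine ⟨a, by exact_mod_cast hda, ?_, ?_, ?_⟩
    · unfold occ; rw [e1, mem_iff_cnt]; omega
    · unfold occ; rw [e2, mem_iff_cnt]; omega
    · rw [e1, e2]
      intro y
      unfold cnt at a1 a2 ⊢
      rw [h5]
      by_cases y1 : y = a
      · subst y1; simp [a1, hne]
      · by_cases y2 : y = b
        · subst y2; simp [a2, hne.symm]
        · simp [y1, y2]

end BPartition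
namespace BPartition

/-- standing numerical assumptions -/
structure Par (h i : ℕ) : Prop where
  odd : h % 2 = 1
  pos : 1 ≤ i
  lt : 2 * i + 2 < h

theorem small {h : ℕ} {k r : ℤ} (h1 : k * h = r) (h2 : -(h:ℤ) < r) (h3 : r < h) :
    k = 0 ∧ r = 0 := by
  have hk : k = 0 := by
    by_contra hk
    rcases lt_or_gt_of_ne hk with h4 | h4
    · have : k ≤ -1 := by omega
      nlinarith
    · have : 1 ≤ k := by omega
      nlinarith
  subst hk; simp at h1; exact ⟨rfl, h1.symm⟩

/-- residues considered -/
def Q (i q : ℕ) : Prop := q = i ∨ q = i + 1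

theorem pos_inj {h i : ℕ} (P : Par h i) {q q' : ℕ} (hq : Q i q) (hq' : Q i q') {k k' : ℤ}
    (he : (k * h + q).natAbs = (k' * h + q').natAbs) : k = k' ∧ q = q' := by
  have := P.pos
  have := P.lt
  unfold Q at hq hq'
  rcases Int.natAbs_eq_natAbs_iff.mp he with h1 | h1
  · have := small (h := h) (k := k - k') (r := q' - q) (by linarith [sub_mul k k' (h:ℤ)])
      (by omega) (by omega)
    omega
  · have := small (h := h) (k := k + k') (r := -(q' + q)) (by linarith [add_mul k k' (h:ℤ)])
      (by omega) (by omega)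
    omega

theorem pos_ndvd {h i : ℕ} (P : Par h i) {q : ℕ} (hq : Q i q) (k : ℤ) :
    ¬ (h:ℤ) ∣ k * h + q := by
  rintro ⟨m, hm⟩
  have := P.pos
  have := P.lt
  unfold Q at hq
  have := small (h := h) (k := m - k) (r := q) (by linarith [sub_mul m k (h:ℤ), mul_comm m (h:ℤ)])
    (by omega) (by omega)
  omega

theorem pos_ndvd' {h i : ℕ} (P : Par h i) {q : ℕ} (hq : Q i q) (k : ℤ) :
    ¬ h ∣ (k * h + q).natAbs := by
  rw [← Int.natCast_dvd]; exact pos_ndvd P hq k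

/-- the runner of residue q -/
def run (h q : ℕ) (lam : BPartition) (k : ℤ) : Prop := occ lam (k * h + q)

/-- same parts outside the runners i, i+1 -/
def Rest (h i : ℕ) (lam mu : BPartition) : Prop :=
  ∀ y : ℕ, (∀ k : ℤ, ∀ q, Q i q → y ≠ (k * h + q).natAbs) → cnt mu y = cnt lam y

theorem Rest.trans {h i : ℕ} {a b c : BPartition} (h1 : Rest h i a b) (h2 : Rest h i b c) :
    Rest h i a c := fun y hy => (h2 y hy).trans (h1 y hy)

theorem Rest.symm {h i : ℕ} {a b : BPartition} (h1 : Rest h i a b) :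
    Rest h i b a := fun y hy => (h1 y hy).symm

theorem flip_run {h i : ℕ} (P : Par h i) {lam mu : BPartition} {q q' : ℕ} (hq : Q i q)
    (hq' : Q i q') {k k' : ℤ}
    (hf : Flip2 lam mu (k * h + q).natAbs (k' * h + q').natAbs) :
    Rest h i lam mu ∧ ∀ p, Q i p → ∀ j, (run h p mu j ↔
      (((j = k ∧ p = q) ∨ (j = k' ∧ p = q')) ∧ ¬ run h p lam j ∨
        ¬ ((j = k ∧ p = q) ∨ (j = k' ∧ p = q')) ∧ run h p lam j)) := by
  constructor
  · intro y hy
    rw [hf y, if_neg]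
    rintro (h1 | h1)
    · exact hy _ _ hq h1
    · exact hy _ _ hq' h1
  · intro p hp j
    have e1 : (j * h + p).natAbs = (k * h + q).natAbs ↔ (j = k ∧ p = q) :=
      ⟨fun e => pos_inj P hp hq e, by rintro ⟨rfl, rfl⟩; rfl⟩
    have e2 : (j * h + p).natAbs = (k' * h + q').natAbs ↔ (j = k' ∧ p = q') :=
      ⟨fun e => pos_inj P hp hq' e, by rintro ⟨rfl, rfl⟩; rfl⟩
    unfold run occ
    rw [hf.mem, e1, e2]
    generalize ((j = k ∧ p = q) ∨ (j = k' ∧ p = q')) = X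
    generalize ((j * h + p).natAbs ∈ partsM lam) = Y
    generalize ((0:ℤ) < j * h + p) = Z
    by_cases X <;> by_cases Y <;> by_cases Z <;> simp_all

theorem eq_of_run {h i : ℕ} (P : Par h i) {lam mu : BPartition} (hl : IsHStrict h lam)
    (hm : IsHStrict h mu) (hr : Rest h i lam mu)
    (hA : ∀ q, Q i q → ∀ k, run h q mu k ↔ run h q lam k) : lam = mu := by
  apply eq_of_cnt
  intro y
  by_cases hy : ∀ k : ℤ, ∀ q, Q i q → y ≠ (k * h + q).natAbs
  · exact (hr y hy).symm
  · push Not at hy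
    obtain ⟨k, q, hq, rfl⟩ := hy
    have h1 := hA q hq k
    unfold run occ at h1
    rw [mem_iff_cnt, mem_iff_cnt] at h1
    have h2 := hstrict_iff.mp hl _ (pos_ndvd' P hq k)
    have h3 := hstrict_iff.mp hm _ (pos_ndvd' P hq k)
    omega

/-- bead move on a runner -/
def mv (A A' : ℤ → Prop) (k : ℤ) : Prop :=
  A k ∧ ¬ A (k - 1) ∧ ∀ j, A' j ↔ (A j ∧ j ≠ k) ∨ j = k - 1

/-- one step, abstractly -/
def AStep (A B A' B' : ℤ → Prop) (R : Prop) : Prop :=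
  ((∀ k, A' k ↔ A k) ∧ (∀ k, B' k ↔ B k)) ∨
  ((∃ k, mv A A' k) ∧ (∀ k, B' k ↔ B k) ∧ R) ∨
  ((∀ k, A' k ↔ A k) ∧ (∃ k, mv B B' k) ∧ R)

theorem AStep.swap {A B A' B' : ℤ → Prop} {R : Prop} (h : AStep A B A' B' R) :
    AStep B A B' A' R := by
  unfold AStep at *; tauto

theorem occ_neg {lam : BPartition} {x : ℤ} (hx : x ≠ 0) : occ lam (-x) ↔ ¬ occ lam x := by
  unfold occ
  rw [Int.natAbs_neg]
  have : (0 < -x) ↔ ¬ (0 < x) := by omega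
  rw [this]; tauto

theorem flip_comm {lam mu : BPartition} {u v : ℕ} (h : Flip2 lam mu u v) : Flip2 lam mu v u := by
  intro y; rw [h y]; simp only [or_comm]

theorem sub_pos_eq (k : ℤ) (h q : ℕ) : k * h + q - h = (k - 1) * h + q := by ring

theorem step_on {h i : ℕ} (P : Par h i) {lam mu : BPartition} {q : ℕ} (hq : Q i q) {k : ℤ}
    (h1 : occ lam (k * h + q)) (h2 : ¬ occ lam (k * h + q - h))
    (hf : Flip2 lam mu (k * h + q).natAbs (k * h + q - h).natAbs) :
    mv (run h q lam) (run h q mu) k ∧ Rest h i lam mu ∧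
      ∀ p, Q i p → p ≠ q → ∀ j, run h p mu j ↔ run h p lam j := by
  rw [sub_pos_eq] at h2 hf
  obtain ⟨hR, hrun⟩ := flip_run P hq hq hf
  refine ⟨⟨h1, h2, ?_⟩, hR, ?_⟩
  · intro j
    rw [hrun q hq j]
    by_cases e1 : j = k
    · subst e1
      have : run h q lam j := h1
      have h3 : ¬ (j = j - 1) := by omega
      simp [this, h3]
    · by_cases e2 : j = k - 1
      · subst e2
        have : ¬ run h q lam (k-1) := h2
        simp [this]
      · simp [e1, e2]
  · intro p hp hne j
    rw [hrun p hp j]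
    simp [hne]

theorem step_forward {h i : ℕ} (P : Par h i) {lam mu : BPartition} (hs : IsHStrict h lam)
    (hb : barStep h lam mu) :
    AStep (run h i lam) (run h (i+1) lam) (run h i mu) (run h (i+1) mu) (Rest h i lam mu) := by
  rcases bar_forward P.odd hs hb with ⟨-, h1⟩ | ⟨x, hx, h1, h2, hf⟩
  · left
    have : ∀ q, Q i q → ∀ k, run h q mu k ↔ run h q lam k := by
      intro q hq k
      unfold run occ
      rw [mem_iff_cnt, mem_iff_cnt, h1 _ (pos_ndvd' P hq k)]
    exact ⟨this i (Or.inl rfl), this (i+1) (Or.inr rfl)⟩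
  · -- reduce to the position being on the runner
    have key : ∀ (x : ℤ), occ lam x → ¬ occ lam (x - h) → Flip2 lam mu x.natAbs (x - h).natAbs →
        ∀ k q, Q i q → x = k * h + q → 
        AStep (run h i lam) (run h (i+1) lam) (run h i mu) (run h (i+1) mu) (Rest h i lam mu) := by
      intro x h1 h2 hf k q hq hxe
      subst hxe
      obtain ⟨a, b, c⟩ := step_on P hq h1 h2 hf
      rcases hq with rfl | rfl
      · exact Or.inr (Or.inl ⟨⟨k, a⟩, c _ (Or.inr rfl) (by omega), b⟩)
      · exact Or.inr (Or.inr ⟨c _ (Or.inl rfl) (by omega), ⟨k, a⟩, b⟩)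
    have hx0 : x ≠ 0 := by rintro rfl; simp at hx
    have hx1 : x - h ≠ 0 := by intro hc; apply hx; rw [sub_eq_zero.mp hc]
    by_cases c1 : ∃ k q, Q i q ∧ x = k * h + q
    · obtain ⟨k, q, hq, he⟩ := c1
      exact key x h1 h2 hf k q hq he
    by_cases c2 : ∃ k q, Q i q ∧ h - x = k * (h:ℤ) + q
    · obtain ⟨k, q, hq, he⟩ := c2
      have e1 : (h:ℤ) - x = -(x - h) := by ring
      have e2 : (h:ℤ) - x - h = -x := by ring
      refine key (h - x) ?_ ?_ ?_ k q hq he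
      · rw [e1, occ_neg hx1]; exact h2
      · rw [e2, occ_neg hx0]; exact not_not.mpr h1
      · rw [e2, e1, Int.natAbs_neg, Int.natAbs_neg]; exact flip_comm hf
    · left
      have : ∀ q, Q i q → ∀ k, run h q mu k ↔ run h q lam k := by
        intro q hq k
        unfold run occ
        rw [hf.mem]
        have : ¬ ((k * h + q).natAbs = x.natAbs ∨ (k * h + q).natAbs = (x - h).natAbs) := by
          rintro (he | he) <;> rcases Int.natAbs_eq_natAbs_iff.mp he with e | e
          · exact c1 ⟨k, q, hq, e.symm⟩
          · exact c2 ⟨k + 1, q, hq, by linarith⟩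
          · exact c1 ⟨k + 1, q, hq, by linarith⟩
          · exact c2 ⟨k, q, hq, by linarith⟩
        simp [this]
      exact ⟨this i (Or.inl rfl), this (i+1) (Or.inr rfl)⟩

theorem step_backward {h i : ℕ} (P : Par h i) {lam : BPartition} (hs : IsHStrict h lam)
    {q : ℕ} (hq : Q i q) {k : ℤ} (h1 : run h q lam k) (h2 : ¬ run h q lam (k - 1)) :
    ∃ mu, IsHStrict h mu ∧ barStep h lam mu ∧ mv (run h q lam) (run h q mu) k ∧
      Rest h i lam mu ∧ ∀ p, Q i p → p ≠ q → ∀ j, run h p mu j ↔ run h p lam j := by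
  have h2' : ¬ occ lam (k * h + q - h) := by rw [sub_pos_eq]; exact h2
  obtain ⟨mu, hmu, hb, hf⟩ := bar_backward P.odd hs (pos_ndvd P hq k) h1 h2'
  exact ⟨mu, hmu, hb, step_on P hq h1 h2' hf⟩

/-- characterization of cores -/
theorem core_iff {h : ℕ} (hodd : h % 2 = 1) {lam : BPartition} :
    IsBarCore h lam ↔ IsHStrict h lam ∧ (∀ v ∈ partsM lam, ¬ h ∣ v) ∧
      ∀ x : ℤ, ¬ (h:ℤ) ∣ x → occ lam x → occ lam (x - h) := by
  constructor
  · rintro ⟨hs, hc⟩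
    refine ⟨hs, ?_, ?_⟩
    · intro v hv hd
      obtain ⟨mu, hmu⟩ := mult_step hs hv hd
      exact hc mu hmu
    · intro x hx h1
      by_contra h2
      obtain ⟨mu, -, hb, -⟩ := bar_backward hodd hs hx h1 h2
      exact hc mu hb
  · rintro ⟨hs, h1, h2⟩
    refine ⟨hs, fun mu hb => ?_⟩
    rcases bar_forward hodd hs hb with ⟨⟨v, hv, hd⟩, -⟩ | ⟨x, hx, h3, h4, -⟩
    · exact h1 v hv hd
    · exact h4 (h2 x hx h3)

theorem core_run {h i : ℕ} (P : Par h i) {lam : BPartition} (hc : IsBarCore h lam) {q : ℕ}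
    (hq : Q i q) {k : ℤ} (h1 : run h q lam k) : run h q lam (k - 1) := by
  unfold run at *
  rw [← sub_pos_eq]
  exact ((core_iff P.odd).mp hc).2.2 _ (pos_ndvd P hq k) h1

theorem core_of_rest {h i : ℕ} (P : Par h i) {lam mu : BPartition} (hc : IsBarCore h lam)
    (hs : IsHStrict h mu) (hr : Rest h i lam mu)
    (hd : ∀ q, Q i q → ∀ k, run h q mu k → run h q mu (k - 1)) : IsBarCore h mu := by
  rw [core_iff P.odd] at hc ⊢
  obtain ⟨-, c1, c2⟩ := hc
  refine ⟨hs, ?_, ?_⟩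
  · intro v hv hdv
    apply c1 v _ hdv
    rw [mem_iff_cnt] at hv ⊢
    rwa [← hr v]
    rintro k q hq rfl
    exact pos_ndvd' P hq k hdv
  · intro x hx h1
    have hx0 : x ≠ 0 := by rintro rfl; simp at hx
    have hx1 : x - h ≠ 0 := by intro hc; apply hx; rw [sub_eq_zero.mp hc]
    by_cases e1 : ∃ k q, Q i q ∧ x = k * h + q
    · obtain ⟨k, q, hq, rfl⟩ := e1
      rw [sub_pos_eq]; exact hd q hq k h1
    by_cases e2 : ∃ k q, Q i q ∧ h - x = k * (h:ℤ) + q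
    · obtain ⟨k, q, hq, he⟩ := e2
      by_contra h2
      have a1 : occ mu (h - x) := by
        rw [show (h:ℤ) - x = -(x - h) by ring, occ_neg hx1]; exact h2
      rw [he] at a1
      have a2 := hd q hq k a1
      unfold run at a2
      rw [← sub_pos_eq, ← he, show (h:ℤ) - x - h = - x by ring, occ_neg hx0] at a2
      exact a2 h1
    · have n1 : ∀ k : ℤ, ∀ q, Q i q → x.natAbs ≠ (k * h + q).natAbs := by
        intro k q hq he
        rcases Int.natAbs_eq_natAbs_iff.mp he with e | e
        · exact e1 ⟨k, q, hq, e⟩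
        · exact e2 ⟨k + 1, q, hq, by linarith⟩
      have n2 : ∀ k : ℤ, ∀ q, Q i q → (x - h).natAbs ≠ (k * h + q).natAbs := by
        intro k q hq he
        rcases Int.natAbs_eq_natAbs_iff.mp he with e | e
        · exact e1 ⟨k + 1, q, hq, by linarith⟩
        · exact e2 ⟨k, q, hq, by linarith⟩
      have := c2 x hx
      unfold occ at *
      simp only [mem_iff_cnt, ← hr _ n1, ← hr _ n2] at this h1 ⊢
      exact this h1

theorem mv_inv {A A' : ℤ → Prop} {k : ℤ} (h : mv A A' k) :
    A' (k - 1) ∧ ¬ A' k ∧ ∀ j, A j ↔ (A' j ∧ j ≠ k - 1) ∨ j = k := by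
  obtain ⟨h1, h2, h3⟩ := h
  refine ⟨(h3 _).mpr (Or.inr rfl), ?_, ?_⟩
  · rw [h3]; simp; omega
  · intro j
    rw [h3 j]
    by_cases e1 : j = k
    · subst e1; simp [h1]
    · by_cases e2 : j = k - 1
      · subst e2; simp [h2]
      · simp [e1, e2]

/-- abstract classification of exceptional configurations -/
theorem classify {A2 B2 A1 B1 A0 B0 : ℤ → Prop} {R2 R1 : Prop} {b : ℤ}
    (s1 : AStep A2 B2 A1 B1 R2) (s0 : AStep A1 B1 A0 B0 R1)
    (hA : ∀ k, A0 k ↔ k ≤ b) (hB : ∀ k, B0 k ↔ k < b) (hex : ∃ k, B2 k ∧ ¬ A2 k) :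
    R2 ∧ R1 ∧ ∃ j, b - 1 ≤ j ∧ j ≤ b + 1 ∧ (∀ k, A2 k ↔ k ≤ b + 1 ∧ k ≠ j) ∧
      (∀ k, B2 k ↔ k < b - 1 ∨ k = j) := by
  obtain ⟨m, hm1, hm2⟩ := hex
  rcases s0 with ⟨a0, b0⟩ | ⟨⟨k0, a0⟩, b0, r0⟩ | ⟨a0, ⟨k0, b0⟩, r0⟩ <;>
  rcases s1 with ⟨a1, b1⟩ | ⟨⟨k1, a1⟩, b1, r1⟩ | ⟨a1, ⟨k1, b1⟩, r1⟩
  · rw [← b1, ← b0, hB] at hm1; rw [← a1, ← a0, hA] at hm2; omega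
  · obtain ⟨c1, c2, c3⟩ := mv_inv a1
    simp only [c3, ← b1, ← b0, ← a0, hA, hB] at *; omega
  · obtain ⟨c1, c2, c3⟩ := mv_inv b1
    simp only [c3, ← a1, ← b0, ← a0, hA, hB] at *; omega
  · obtain ⟨d1, d2, d3⟩ := mv_inv a0
    simp only [d3, ← a1, ← b1, ← b0, hA, hB] at *; omega
  · obtain ⟨d1, d2, d3⟩ := mv_inv a0
    obtain ⟨c1, c2, c3⟩ := mv_inv a1
    clear a0 a1
    simp only [d3, c3, ← b1, ← b0, hA, hB] at *
    refine ⟨r1, r0, b - 1, by omega, by omega, fun k => by omega, fun k => by omega⟩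
  · obtain ⟨d1, d2, d3⟩ := mv_inv a0
    obtain ⟨c1, c2, c3⟩ := mv_inv b1
    clear a0 b1
    simp only [d3, c3, ← a1, ← b0, hA, hB] at *
    refine ⟨r1, r0, b, by omega, by omega, fun k => by omega, fun k => by omega⟩
  · obtain ⟨d1, d2, d3⟩ := mv_inv b0
    simp only [d3, ← a1, ← b1, ← a0, hA, hB] at *; omega
  · obtain ⟨d1, d2, d3⟩ := mv_inv b0
    obtain ⟨c1, c2, c3⟩ := mv_inv a1
    clear b0 a1
    simp only [d3, c3, ← b1, ← a0, hA, hB] at *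
    refine ⟨r1, r0, b, by omega, by omega, fun k => by omega, fun k => by omega⟩
  · obtain ⟨d1, d2, d3⟩ := mv_inv b0
    obtain ⟨c1, c2, c3⟩ := mv_inv b1
    clear b0 b1
    simp only [d3, c3, ← a1, ← a0, hA, hB] at *
    refine ⟨r1, r0, b + 1, by omega, by omega, fun k => by omega, fun k => by omega⟩

end BPartition
namespace BPartition

/-- exceptional configurations -/
def Exc (h q q' : ℕ) (b j : ℤ) (lam : BPartition) : Prop :=
  (∀ k, run h q lam k ↔ k ≤ b + 1 ∧ k ≠ j) ∧ (∀ k, run h q' lam k ↔ k < b - 1 ∨ k = j)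

theorem block_forward {h i : ℕ} (P : Par h i) {σ lam : BPartition}
    {q q' : ℕ} (hqq : (q = i ∧ q' = i + 1) ∨ (q = i + 1 ∧ q' = i)) {b : ℤ}
    (hA : ∀ k, run h q σ k ↔ k ≤ b) (hB : ∀ k, run h q' σ k ↔ k < b)
    (hb : InBlock h σ 2 lam) (hex : ∃ k, run h q' lam k ∧ ¬ run h q lam k) :
    IsHStrict h lam ∧ Rest h i σ lam ∧ ∃ j, b - 1 ≤ j ∧ j ≤ b + 1 ∧ Exc h q q' b j lam := by
  obtain ⟨hs, -, nu, s1, mu, s0, he⟩ := hb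
  change mu = σ at he
  subst he
  have hnu : IsHStrict h nu := by obtain ⟨v, hv⟩ := s1; exact hv.1
  have f1 := step_forward P hs s1
  have f0 := step_forward P hnu s0
  rcases hqq with ⟨rfl, rfl⟩ | ⟨rfl, rfl⟩
  · obtain ⟨r1, r0, j, j1, j2, j3, j4⟩ := classify f1 f0 hA hB hex
    exact ⟨hs, (r1.trans r0).symm, j, j1, j2, j3, j4⟩
  · obtain ⟨r1, r0, j, j1, j2, j3, j4⟩ := classify f1.swap f0.swap hA hB hex
    exact ⟨hs, (r1.trans r0).symm, j, j1, j2, j3, j4⟩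

theorem block_backward {h i : ℕ} (P : Par h i) {σ lam : BPartition} (hσ : IsBarCore h σ)
    {q q' : ℕ} (hqq : (q = i ∧ q' = i + 1) ∨ (q = i + 1 ∧ q' = i)) {b : ℤ}
    (hA : ∀ k, run h q σ k ↔ k ≤ b) (hB : ∀ k, run h q' σ k ↔ k < b)
    (hs : IsHStrict h lam) (hr : Rest h i σ lam) {j : ℤ} (j1 : b - 1 ≤ j) (j2 : j ≤ b + 1)
    (he : Exc h q q' b j lam) :
    InBlock h σ 2 lam ∧ run h q' lam j ∧ ¬ run h q lam j := by
  have hq : Q i q := by unfold Q; omega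
  have hq' : Q i q' := by unfold Q; omega
  have hne : q ≠ q' := by omega
  obtain ⟨e1, e2⟩ := he
  refine ⟨⟨hs, hσ, ?_⟩, by rw [e2]; simp, by rw [e1]; simp⟩
  have fin : ∀ nu mu, barStep h lam nu → barStep h nu mu → Rest h i lam nu → Rest h i nu mu →
      IsHStrict h mu → (∀ k, run h q mu k ↔ k ≤ b) → (∀ k, run h q' mu k ↔ k < b) →
      barChain h 2 lam σ := by
    intro nu mu s1 s0 r1 r0 hm a b
    refine ⟨nu, s1, mu, s0, ?_⟩
    change mu = σ
    symm
    apply eq_of_run P hσ.1 hm (hr.trans (r1.trans r0))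
    intro p hp k
    have : p = q ∨ p = q' := by unfold Q at hp; omega
    rcases this with rfl | rfl
    · rw [hA, a]
    · rw [hB, b]
  have : j = b - 1 ∨ j = b ∨ j = b + 1 := by omega
  rcases this with rfl | rfl | rfl
  · obtain ⟨nu, n1, n2, n3, n4, n5⟩ := step_backward P hs hq (k := b) (by rw [e1]; omega)
      (by rw [e1]; omega)
    have g1 : ∀ k, run h q nu k ↔ k < b ∨ k = b + 1 := by
      intro k; rw [n3.2.2, e1]; omega
    have g2 : ∀ k, run h q' nu k ↔ k < b := by
      intro k; rw [n5 _ hq' hne.symm, e2]; omega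
    obtain ⟨mu, m1, m2, m3, m4, m5⟩ := step_backward P n1 hq (k := b + 1) (by rw [g1]; omega)
      (by rw [g1]; omega)
    refine fin nu mu n2 m2 n4 m4 m1 ?_ ?_
    · intro k; rw [m3.2.2, g1]; omega
    · intro k; rw [m5 _ hq' hne.symm, g2]
  · obtain ⟨nu, n1, n2, n3, n4, n5⟩ := step_backward P hs hq (k := j + 1) (by rw [e1]; omega)
      (by rw [e1]; omega)
    have g1 : ∀ k, run h q nu k ↔ k ≤ j := by
      intro k; rw [n3.2.2, e1]; omega
    have g2 : ∀ k, run h q' nu k ↔ k < j - 1 ∨ k = j := by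
      intro k; rw [n5 _ hq' hne.symm, e2]
    obtain ⟨mu, m1, m2, m3, m4, m5⟩ := step_backward P n1 hq' (k := j) (by rw [g2]; omega)
      (by rw [g2]; omega)
    refine fin nu mu n2 m2 n4 m4 m1 ?_ ?_
    · intro k; rw [m5 _ hq hne, g1]
    · intro k; rw [m3.2.2, g2]; omega
  · obtain ⟨nu, n1, n2, n3, n4, n5⟩ := step_backward P hs hq' (k := b + 1) (by rw [e2]; omega)
      (by rw [e2]; omega)
    have g1 : ∀ k, run h q nu k ↔ k ≤ b := by
      intro k; rw [n5 _ hq hne, e1]; omega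
    have g2 : ∀ k, run h q' nu k ↔ k < b - 1 ∨ k = b := by
      intro k; rw [n3.2.2, e2]; omega
    obtain ⟨mu, m1, m2, m3, m4, m5⟩ := step_backward P n1 hq' (k := b) (by rw [g2]; omega)
      (by rw [g2]; omega)
    refine fin nu mu n2 m2 n4 m4 m1 ?_ ?_
    · intro k; rw [m5 _ hq hne, g1]
    · intro k; rw [m3.2.2, g2]; omega

/-! nodes -/

/-- column of the node between positions kh+i and kh+i+1 -/
def col (h i : ℕ) (k : ℤ) : ℕ := max (k * h + (i:ℕ)).natAbs (k * h + ((i + 1 : ℕ) : ℤ)).natAbs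

theorem col_spec {h i : ℕ} (P : Par h i) (k : ℤ) :
    (0 < k * h + (i:ℕ) ∧ 0 < k * h + ((i+1 : ℕ) : ℤ) ∧ col h i k = (k * h + ((i + 1 : ℕ) : ℤ)).natAbs ∧
      col h i k = (k * h + (i:ℕ)).natAbs + 1 ∧ (col h i k : ℤ) = k * h + i + 1) ∨
    (k * h + (i:ℕ) < 0 ∧ k * h + ((i+1 : ℕ) : ℤ) < 0 ∧ col h i k = (k * h + (i:ℕ)).natAbs ∧
      col h i k = (k * h + ((i + 1 : ℕ) : ℤ)).natAbs + 1 ∧ (col h i k : ℤ) = - (k * h + i)) := by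
  have h1 := P.pos
  have h2 := P.lt
  unfold col
  rcases le_or_gt 0 k with hk | hk
  · left
    have : 0 ≤ k * h := by positivity
    omega
  · right
    have : k * h ≤ -h := by nlinarith
    omega

theorem run_iff {h i : ℕ} (P : Par h i) {lam : BPartition} {k : ℤ} :
    ((run h i lam k ∧ ¬ run h (i+1) lam k) ↔
      (col h i k - 1 ∈ partsM lam ∧ col h i k ∉ partsM lam)) ∧
    ((run h (i+1) lam k ∧ ¬ run h i lam k) ↔
      (col h i k ∈ partsM lam ∧ col h i k - 1 ∉ partsM lam)) := by
  unfold run occ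
  rcases col_spec P k with ⟨a, b, c, d, -⟩ | ⟨a, b, c, d, -⟩
  · rw [← c, show (k * h + (i:ℕ)).natAbs = col h i k - 1 by omega]
    simp only [a, b]; tauto
  · rw [← c, show (k * h + ((i+1:ℕ):ℤ)).natAbs = col h i k - 1 by omega]
    simp only [not_lt.mpr a.le, not_lt.mpr b.le]; tauto

theorem col_ndvd {h i : ℕ} (P : Par h i) (k : ℤ) : ¬ h ∣ col h i k ∧ ¬ h ∣ col h i k - 1 := by
  have a := pos_ndvd' P (q := i) (Or.inl rfl) k
  have b := pos_ndvd' P (q := i+1) (Or.inr rfl) k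
  rcases col_spec P k with ⟨_, _, c, d, -⟩ | ⟨_, _, c, d, -⟩
  · rw [show col h i k - 1 = (k * h + (i:ℕ)).natAbs by omega]; rw [← c] at b; exact ⟨b, a⟩
  · rw [show col h i k - 1 = (k * h + ((i+1:ℕ):ℤ)).natAbs by omega]; rw [← c] at a; exact ⟨a, b⟩

theorem col_inj {h i : ℕ} (P : Par h i) {k k' : ℤ} (he : col h i k = col h i k') : k = k' := by
  have Q1 : Q i i := Or.inl rfl
  have Q2 : Q i (i+1) := Or.inr rfl
  rcases col_spec P k with ⟨_, _, c, d, -⟩ | ⟨_, _, c, d, -⟩ <;>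
  rcases col_spec P k' with ⟨_, _, c', d', -⟩ | ⟨_, _, c', d', -⟩
  · exact (pos_inj P Q2 Q2 (by omega)).1
  · exact (pos_inj P Q2 Q1 (by omega)).1
  · exact (pos_inj P Q1 Q2 (by omega)).1
  · exact (pos_inj P Q1 Q1 (by omega)).1

theorem colRes_iff_mod {h i : ℕ} (P : Par h i) (c : ℕ) :
    colRes h c = i ↔ c % h = i + 1 ∨ c % h = h - i := by
  have h1 := P.pos
  have h2 := P.lt
  unfold colRes
  have hm : c % h < h := Nat.mod_lt _ (by omega)
  by_cases h0 : c % h = 0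
  · rw [h0]; simp; omega
  · have e : (c - 1) % h = c % h - 1 := by
      have := Nat.div_add_mod c h
      have e1 : c - 1 = h * (c / h) + (c % h - 1) := by omega
      rw [e1, Nat.mul_add_mod, Nat.mod_eq_of_lt (by omega)]
    rw [e, Nat.mod_eq_of_lt (a := h - c % h) (by omega)]
    omega

theorem colRes_iff {h i : ℕ} (P : Par h i) (c : ℕ) :
    colRes h c = i ↔ ∃ k, c = col h i k := by
  have h1 := P.pos
  have h2 := P.lt
  rw [colRes_iff_mod P]
  have e := Nat.div_add_mod c h
  constructor
  · rintro (hm | hm)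
    · refine ⟨((c / h : ℕ) : ℤ), ?_⟩
      have e' : (c : ℤ) = (c / h : ℕ) * h + i + 1 := by
        rw [hm] at e; rw [mul_comm]; exact_mod_cast e.symm
      rcases col_spec P ((c / h : ℕ) : ℤ) with ⟨a, _, _, _, d⟩ | ⟨a, _, _, _, d⟩
      · omega
      · exfalso; have : (0:ℤ) ≤ (c / h : ℕ) * h := by positivity
        omega
    · refine ⟨-((c / h : ℕ) : ℤ) - 1, ?_⟩
      have e' : (c : ℤ) + i = (c / h : ℕ) * h + h := by
        rw [mul_comm]
        have : c + i = h * (c / h) + h := by omega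
        exact_mod_cast this
      have e2 : (-((c / h : ℕ) : ℤ) - 1) * h = - ((c / h : ℕ) * h + h) := by ring
      have : (0:ℤ) ≤ (c / h : ℕ) * h := by positivity
      rcases col_spec P (-((c / h : ℕ) : ℤ) - 1) with ⟨a, _, _, _, d⟩ | ⟨a, _, _, _, d⟩
      · rw [e2] at a; omega
      · rw [e2] at d; omega
  · rintro ⟨k, rfl⟩
    rcases col_spec P k with ⟨_, _, _, _, d⟩ | ⟨_, _, _, _, d⟩
    · left
      have : ((col h i k : ℕ) : ℤ) % h = (i + 1 : ℤ) := by
        rw [d, show k * h + (i:ℤ) + 1 = (i + 1 : ℤ) + h * k by ring, Int.add_mul_emod_self_left]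
        exact Int.emod_eq_of_lt (by omega) (by omega)
      exact_mod_cast this
    · right
      have : ((col h i k : ℕ) : ℤ) % h = (h - i : ℤ) := by
        rw [d, show -(k * h + (i:ℤ)) = (h - i : ℤ) + h * (-k-1) by ring,
          Int.add_mul_emod_self_left]
        exact Int.emod_eq_of_lt (by omega) (by omega)
      zify [show i ≤ h by omega]
      exact this

theorem colRes_succ {h i : ℕ} (P : Par h i) (c : ℕ) (h1 : colRes h c = i) :
    colRes h (c + 1) ≠ i := by
  have h3 := P.pos
  have h2 := P.lt
  rw [Ne, colRes_iff_mod P]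
  rw [colRes_iff_mod P] at h1
  have e := Nat.div_add_mod c h
  have e1 : c + 1 = h * (c / h) + (c % h + 1) := by omega
  rw [e1, Nat.mul_add_mod]
  have hm : c % h < h := Nat.mod_lt _ (by omega)
  by_cases h0 : c % h + 1 = h
  · rw [h0, Nat.mod_self]; omega
  · rw [Nat.mod_eq_of_lt (by omega)]
    have := P.odd
    omega

/-- move one part by one box -/
theorem move_part {h : ℕ} {lam : BPartition} (hs : IsHStrict h lam) {r q p : ℕ}
    (hr : lam.parts r = q) (hq : ¬ h ∣ q) (hp : ¬ h ∣ p) (hpq : p = q + 1 ∨ q = p + 1)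
    (hpm : p ∉ partsM lam) :
    ∃ mu, IsHStrict h mu ∧ (∀ s, mu.parts s = if s = r then p else lam.parts s) ∧
      Flip2 lam mu q p := by
  classical
  have hq0 : q ≠ 0 := by rintro rfl; simp at hq
  have hp0 : p ≠ 0 := by rintro rfl; simp at hp
  have hlt : ∀ s, r < s → lam.parts s < q := by
    intro s hs'; rw [← hr]; exact hstrict_lt hs hs' (by rw [hr]; exact hq)
  have hgt : ∀ s, s < r → q < lam.parts s := by
    intro s hs'
    have h1 := anti (lam := lam) hs'.le
    rw [hr] at h1
    rcases h1.eq_or_lt with h2 | h2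
    · have := hstrict_lt hs hs' (by rw [← h2]; exact hq); omega
    · exact h2
  let f : ℕ →₀ ℕ := lam.parts.update r p
  have hf : ∀ s, f s = if s = r then p else lam.parts s := by
    intro s; simp [f, Finsupp.update_apply]
  have hmem : ∀ s, lam.parts s ≠ p := fun s hs' => hpm (mem_partsM.mpr ⟨hp0, s, hs'⟩)
  let mu : BPartition := ⟨f, by
    intro s
    rw [hf, hf]
    have := lam.antitone s
    split_ifs with a b b
    · omega
    · have := hgt s (by omega); have := hmem s; omega
    · have := hlt (s+1) (by omega); have := hmem (s+1); omega
    · exact this⟩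
  have hmu : ∀ s, mu.parts s = if s = r then p else lam.parts s := hf
  have hsup : mu.parts.support = lam.parts.support := by
    ext s
    simp only [Finsupp.mem_support_iff, hmu]
    split_ifs with a
    · subst a; rw [hr]; simp [hp0, hq0]
    · rfl
  have hrs : r ∈ lam.parts.support := by simp [hr, hq0]
  have c1 : partsM lam = q ::ₘ (lam.parts.support.erase r).val.map lam.parts := by
    unfold partsM
    rw [← hr, ← Multiset.map_cons, ← Finset.insert_val_of_notMem (by simp),
      Finset.insert_erase hrs]
  have c2 : partsM mu = p ::ₘ (lam.parts.support.erase r).val.map lam.parts := by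
    unfold partsM
    rw [hsup, ← Finset.insert_erase hrs, Finset.insert_val_of_notMem (by simp),
      Multiset.map_cons, hmu r, if_pos rfl, Finset.insert_erase hrs]
    congr 1
    apply Multiset.map_congr rfl
    intro s hs'
    rw [hmu, if_neg]
    exact Finset.ne_of_mem_erase hs'
  have hne : p ≠ q := by omega
  have cq := hstrict_iff.mp hs q hq
  have cp : cnt lam p = 0 := by unfold cnt; exact Multiset.count_eq_zero.mpr hpm
  have hfl : Flip2 lam mu q p := by
    intro y
    unfold cnt at *
    rw [c1] at cq cp
    rw [c2, c1]
    simp only [Multiset.count_cons] at *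
    by_cases y1 : y = q
    · subst y1
      simp only [if_true, true_or, if_neg hne.symm] at cq ⊢
      omega
    · by_cases y2 : y = p
      · subst y2
        simp only [if_true, or_true, if_neg hne] at cp ⊢
        omega
      · simp [y1, y2]
  refine ⟨mu, ?_, hmu, hfl⟩
  rw [hstrict_iff] at hs ⊢
  intro y hy
  rw [hfl y]
  have := hs y hy
  split_ifs <;> omega

theorem col_pos {h i : ℕ} (P : Par h i) (k : ℤ) : 2 ≤ col h i k := by
  have := col_ndvd P k
  by_contra hc
  have : col h i k = 0 ∨ col h i k = 1 := by omega
  rcases this with h1 | h1 <;> simp [h1] at this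

theorem addable_iff {h i : ℕ} (P : Par h i) {lam : BPartition} (hs : IsHStrict h lam)
    {x : ℕ × ℕ} : Addable h i lam x ↔ ∃ k, x.2 = col h i k ∧ lam.parts x.1 + 1 = col h i k ∧
      run h i lam k ∧ ¬ run h (i+1) lam k := by
  obtain ⟨r, c⟩ := x
  constructor
  · rintro ⟨h1, h2, nu, n1, n2, n3, n4⟩
    simp only at h1
    obtain ⟨k, hk⟩ := (colRes_iff P c).mp h1
    have hc2 := col_pos P k
    have hnd := col_ndvd P k
    simp only [diagram, Set.mem_ofPred_eq, not_and, not_le, and_imp, Prod.forall,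
      Set.ofPred_subset_ofPred] at h2 n2 n3 n4
    have hle : ∀ s, lam.parts s ≤ nu.parts s := by
      intro s
      by_contra hc
      have := n2 s (lam.parts s) (by omega) le_rfl
      omega
    have hstep : ∀ s, nu.parts s ≤ lam.parts s + 1 := by
      intro s
      by_contra hc
      have a1 := n4 s (lam.parts s + 1) (by omega) (by omega) (by omega)
      have a2 := n4 s (lam.parts s + 1 + 1) (by omega) (by omega) (by omega)
      exact colRes_succ P _ a1 a2
    have e1 := hstep r
    have e2 := h2 (by omega)
    have e3 : lam.parts r + 1 = c := by omega
    refine ⟨k, hk, by change lam.parts r + 1 = _; omega, (run_iff P).1.mpr ⟨?_, ?_⟩⟩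
    · rw [mem_partsM]; exact ⟨by omega, r, by omega⟩
    · rw [← hk]
      intro hm
      obtain ⟨-, s, hs'⟩ := mem_partsM.mp hm
      have hsr : s < r := by
        by_contra hc
        have := anti (lam := lam) (not_lt.mp hc); omega
      have e4 : nu.parts s = c := by
        have a1 := hle s
        have a2 := hstep s
        by_contra hc
        have a3 := n4 s (c + 1) (by omega) (by omega) (by omega)
        exact colRes_succ P _ h1 a3
      have := hstrict_lt n1 hsr (by rw [e4, hk]; exact hnd.1)
      omega
  · rintro ⟨k, hk, h1, h2⟩
    simp only at hk h1
    obtain ⟨a1, a2⟩ := (run_iff P).1.mp h2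
    have hnd := col_ndvd P k
    have hc2 := col_pos P k
    obtain ⟨mu, m1, m2, m3⟩ := move_part hs (r := r) (q := col h i k - 1) (p := col h i k)
      (by omega) hnd.2 hnd.1 (by omega) a2
    refine ⟨(colRes_iff P c).mpr ⟨k, hk⟩, ?_, mu, m1, ?_, ?_, ?_⟩
    · simp [diagram]; omega
    · rintro ⟨s, d⟩ ⟨d1, d2⟩
      refine ⟨d1, ?_⟩
      simp only [m2] at d2 ⊢
      split_ifs with e
      · subst e; omega
      · exact d2
    · simp only [diagram, Set.mem_ofPred_eq, m2]; simp; omega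
    · rintro ⟨s, d⟩ ⟨d1, d2⟩ d3
      simp only [diagram, Set.mem_ofPred_eq, m2, not_and, not_le] at d1 d2 d3 ⊢
      split_ifs at d2 with e
      · subst e
        have := d3 d1
        exact (colRes_iff P d).mpr ⟨k, by omega⟩
      · have := d3 d1; omega

theorem removable_iff {h i : ℕ} (P : Par h i) {lam : BPartition} (hs : IsHStrict h lam)
    {x : ℕ × ℕ} : Removable h i lam x ↔ ∃ k, x.2 = col h i k ∧ lam.parts x.1 = col h i k ∧
      run h (i+1) lam k ∧ ¬ run h i lam k := by
  obtain ⟨r, c⟩ := x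
  constructor
  · rintro ⟨h2, nu, n1, n2, n3, n4⟩
    simp only [diagram, Set.mem_ofPred_eq, not_and, not_le, and_imp, Prod.forall,
      Set.ofPred_subset_ofPred] at h2 n2 n3 n4
    have h1 : colRes h c = i := n4 r c h2.1 h2.2 (fun _ => n3 h2.1)
    obtain ⟨k, hk⟩ := (colRes_iff P c).mp h1
    have hc2 := col_pos P k
    have hnd := col_ndvd P k
    have hle : ∀ s, nu.parts s ≤ lam.parts s := by
      intro s
      by_contra hc
      have := n2 s (nu.parts s) (by omega) le_rfl
      omega
    have hstep : ∀ s, lam.parts s ≤ nu.parts s + 1 := by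
      intro s
      by_contra hc
      have a1 := n4 s (nu.parts s + 1) (by omega) (by omega) (by omega)
      have a2 := n4 s (nu.parts s + 1 + 1) (by omega) (by omega) (by omega)
      exact colRes_succ P _ a1 a2
    have e1 := hstep r
    have e2 := n3 (by omega)
    have e3 : lam.parts r = c := by omega
    refine ⟨k, hk, by change lam.parts r = _; omega, (run_iff P).2.mpr ⟨?_, ?_⟩⟩
    · rw [mem_partsM]; exact ⟨by omega, r, by omega⟩
    · rw [← hk]
      intro hm
      obtain ⟨-, s, hs'⟩ := mem_partsM.mp hm
      have hsr : r < s := by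
        by_contra hc
        have := anti (lam := lam) (not_lt.mp hc); omega
      have e4 : nu.parts s = c - 1 := by
        have a1 := hle s
        have a2 := hstep s
        by_contra hc
        have a3 := n4 s (c - 1) (by omega) (by omega) (by omega)
        refine colRes_succ P _ a3 ?_
        rw [show c - 1 + 1 = c by omega]; exact h1
      have := hstrict_lt n1 hsr (by rw [show nu.parts r = c - 1 by omega, hk]; exact hnd.2)
      omega
  · rintro ⟨k, hk, h1, h2⟩
    simp only at hk h1
    obtain ⟨a1, a2⟩ := (run_iff P).2.mp h2
    have hnd := col_ndvd P k
    have hc2 := col_pos P k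
    obtain ⟨mu, m1, m2, m3⟩ := move_part hs (r := r) (q := col h i k) (p := col h i k - 1)
      (by omega) hnd.1 hnd.2 (by omega) a2
    refine ⟨?_, mu, m1, ?_, ?_, ?_⟩
    · simp [diagram]; omega
    · rintro ⟨s, d⟩ ⟨d1, d2⟩
      refine ⟨d1, ?_⟩
      simp only [m2] at d2 ⊢
      split_ifs at d2 with e
      · subst e; omega
      · exact d2
    · simp only [diagram, Set.mem_ofPred_eq, m2]; simp; omega
    · rintro ⟨s, d⟩ ⟨d1, d2⟩ d3
      simp only [diagram, Set.mem_ofPred_eq, m2, not_and, not_le] at d1 d2 d3 ⊢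
      have := d3 d1
      split_ifs at this with e
      · subst e
        exact (colRes_iff P d).mpr ⟨k, by omega⟩
      · omega

end BPartition
namespace BPartition

theorem diagram_inj {lam mu : BPartition} (h : diagram lam = diagram mu) : lam = mu := by
  have key : ∀ a b : BPartition, diagram a ⊆ diagram b → ∀ r, a.parts r ≤ b.parts r := by
    intro a b hab r
    by_contra hc
    have : (r, a.parts r) ∈ diagram b := hab ⟨by change 1 ≤ a.parts r; omega, le_rfl⟩
    have := this.2
    change a.parts r ≤ b.parts r at this
    omega
  apply parts_inj
  ext r
  exact le_antisymm (key _ _ h.subset r) (key _ _ h.symm.subset r)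

theorem psi_eq {h i : ℕ} {lam mu : BPartition} (he : diagram mu = psiSet h i lam) :
    psi h i lam = mu := by
  have hex : ∃ mu : BPartition, diagram mu = psiSet h i lam := ⟨mu, he⟩
  unfold psi
  rw [dif_pos hex]
  exact diagram_inj (hex.choose_spec.trans he.symm)

open Classical in
theorem nc1 (p : ℕ × ℕ) (X : ℕ × ℕ → Prop) :
    Set.ncard {y | y = p ∧ X y} = if X p then 1 else 0 := by
  split_ifs with h
  · rw [show {y | y = p ∧ X y} = {p} by
      ext y; simp only [Set.mem_ofPred_eq, Set.mem_singleton_iff]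
      constructor
      · exact fun a => a.1
      · rintro rfl; exact ⟨rfl, h⟩]
    exact Set.ncard_singleton _
  · rw [show {y | y = p ∧ X y} = ∅ by
      ext y; simp only [Set.mem_ofPred_eq, Set.mem_empty_iff_false, iff_false]
      rintro ⟨rfl, a⟩; exact h a]
    exact Set.ncard_empty _

open Classical in
theorem nc2 {p q : ℕ × ℕ} (hpq : p ≠ q) (X : ℕ × ℕ → Prop) :
    Set.ncard {y | (y = p ∨ y = q) ∧ X y} = (if X p then 1 else 0) + (if X q then 1 else 0) := by
  rw [← nc1 p X, ← nc1 q X, ← Set.ncard_union_eq ?_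
    ((Set.finite_singleton p).subset (fun y hy => hy.1))
    ((Set.finite_singleton q).subset (fun y hy => hy.1))]
  · congr 1
    ext y; simp only [Set.mem_ofPred_eq, Set.mem_union]; tauto
  · rw [Set.disjoint_left]
    rintro y ⟨rfl, -⟩ ⟨e, -⟩; exact hpq e

theorem nc1' (p : ℕ × ℕ) : Set.ncard {y | y = p} = 1 := by
  simp

theorem nc2' {p q : ℕ × ℕ} (hpq : p ≠ q) : Set.ncard {y | y = p ∨ y = q} = 2 := by
  have := nc2 hpq (fun _ => True); simpa using this

theorem nc0 (X : ℕ × ℕ → Prop) : Set.ncard {y | False ∧ X y} = 0 := by simp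

theorem nc0' : Set.ncard {_y : ℕ × ℕ | False} = 0 := by simp

theorem psiSet_of {h i : ℕ} {lam : BPartition} {N C : ℕ × ℕ → Prop}
    (hN : ∀ x, Normal h i lam x ↔ N x) (hC : ∀ x, Conormal h i lam x ↔ C x)
    (hle : Set.ncard {x | N x} ≤ Set.ncard {x | C x}) :
    psiSet h i lam = diagram lam ∪ {x | C x ∧
      Set.ncard {y | C y ∧ posLE y x} ≤ Set.ncard {x | C x} - Set.ncard {x | N x}} := by
  unfold psiSet
  simp only [hN, hC, if_pos hle]

theorem sig0 {h i : ℕ} {lam : BPartition} {x1 : ℕ × ℕ}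
    (hA : ∀ x, Addable h i lam x ↔ x = x1) (hR : ∀ x, Removable h i lam x ↔ False) :
    psiSet h i lam = diagram lam ∪ {x1} := by
  have hN : ∀ x, Normal h i lam x ↔ False := by
    intro x; unfold Normal; simp [hR]
  have hC : ∀ x, Conormal h i lam x ↔ x = x1 := by
    intro x; unfold Conormal; simp only [hA, hR, nc1, nc0]
    constructor
    · exact fun a => a.1
    · rintro rfl
      refine ⟨rfl, fun z hz => ?_⟩
      rw [if_pos]
      · norm_num
      · exact ⟨Or.inr ⟨rfl, le_rfl⟩, hz⟩
  rw [psiSet_of hN hC (by simp)]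
  congr 1
  ext x
  simp only [Set.mem_ofPred_eq, nc1, nc1', nc0', Set.mem_singleton_iff]
  constructor
  · exact fun a => a.1
  · intro a; refine ⟨a, ?_⟩; split_ifs <;> omega

section sig
variable {h i : ℕ} {lam : BPartition} {x1 x2 x3 : ℕ × ℕ}

theorem sig1 (h12 : x1.2 < x2.2) (h23 : x2.2 < x3.2)
    (hA : ∀ x, Addable h i lam x ↔ x = x2 ∨ x = x3) (hR : ∀ x, Removable h i lam x ↔ x = x1) :
    psiSet h i lam = diagram lam ∪ {x2} := by
  have n23 : x2 ≠ x3 := by rintro rfl; omega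
  have hN : ∀ x, Normal h i lam x ↔ x = x1 := by
    intro x; unfold Normal; simp only [hA, hR, nc1, nc2 n23]
    constructor
    · exact fun a => a.1
    · rintro rfl
      refine ⟨rfl, fun z hz => ?_⟩
      unfold posLE at *
      split_ifs <;> omega
  have hC : ∀ x, Conormal h i lam x ↔ x = x2 ∨ x = x3 := by
    intro x; unfold Conormal; simp only [hA, hR, nc1, nc2 n23]
    constructor
    · exact fun a => a.1
    · rintro (rfl | rfl)
      · refine ⟨Or.inl rfl, fun z hz => ?_⟩
        unfold posLE at *
        split_ifs <;> omega
      · refine ⟨Or.inr rfl, fun z hz => ?_⟩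
        unfold posLE at *
        split_ifs <;> omega
  rw [psiSet_of hN hC (by rw [nc1', nc2' n23]; omega)]
  congr 1
  ext x
  simp only [Set.mem_ofPred_eq, nc2 n23, nc1', nc2' n23, Set.mem_singleton_iff]
  constructor
  · rintro ⟨rfl | rfl, a⟩
    · rfl
    · exfalso; unfold posLE at a
      split_ifs at a <;> omega
  · rintro rfl
    refine ⟨Or.inl rfl, ?_⟩
    unfold posLE
    split_ifs <;> omega

theorem sig2 (h12 : x1.2 < x2.2) (h23 : x2.2 < x3.2)
    (hA : ∀ x, Addable h i lam x ↔ x = x1 ∨ x = x3) (hR : ∀ x, Removable h i lam x ↔ x = x2) :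
    psiSet h i lam = diagram lam ∪ {x3} := by
  have n13 : x1 ≠ x3 := by rintro rfl; omega
  have hN : ∀ x, Normal h i lam x ↔ False := by
    intro x; unfold Normal; simp only [hA, hR, nc1, nc2 n13, iff_false]
    rintro ⟨rfl, a⟩
    have := a x1 (Or.inl h12)
    unfold posLE at this
    split_ifs at this <;> omega
  have hC : ∀ x, Conormal h i lam x ↔ x = x3 := by
    intro x; unfold Conormal; simp only [hA, hR, nc1, nc2 n13]
    constructor
    · rintro ⟨rfl | rfl, a⟩
      · exfalso
        have := a x2 (Or.inl h12)
        unfold posLE at this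
        split_ifs at this <;> omega
      · rfl
    · rintro rfl
      refine ⟨Or.inr rfl, fun z hz => ?_⟩
      unfold posLE at *
      split_ifs <;> omega
  rw [psiSet_of hN hC (by simp)]
  congr 1
  ext x
  simp only [Set.mem_ofPred_eq, nc1, nc1', nc0', Set.mem_singleton_iff]
  constructor
  · exact fun a => a.1
  · intro a; refine ⟨a, ?_⟩; split_ifs <;> omega

theorem sig3 (h12 : x1.2 < x2.2) (h23 : x2.2 < x3.2)
    (hA : ∀ x, Addable h i lam x ↔ x = x1 ∨ x = x2) (hR : ∀ x, Removable h i lam x ↔ x = x3) :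
    psiSet h i lam = diagram lam ∪ {x1} := by
  have n12 : x1 ≠ x2 := by rintro rfl; omega
  have hN : ∀ x, Normal h i lam x ↔ False := by
    intro x; unfold Normal; simp only [hA, hR, nc1, nc2 n12, iff_false]
    rintro ⟨rfl, a⟩
    have := a x2 (Or.inl h23)
    unfold posLE at this
    split_ifs at this <;> omega
  have hC : ∀ x, Conormal h i lam x ↔ x = x1 := by
    intro x; unfold Conormal; simp only [hA, hR, nc1, nc2 n12]
    constructor
    · rintro ⟨rfl | rfl, a⟩
      · rfl
      · exfalso
        have := a x3 (Or.inl h23)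
        unfold posLE at this
        split_ifs at this <;> omega
    · rintro rfl
      refine ⟨Or.inl rfl, fun z hz => ?_⟩
      unfold posLE at *
      split_ifs <;> omega
  rw [psiSet_of hN hC (by simp)]
  congr 1
  ext x
  simp only [Set.mem_ofPred_eq, nc1, nc1', nc0', Set.mem_singleton_iff]
  constructor
  · exact fun a => a.1
  · intro a; refine ⟨a, ?_⟩; split_ifs <;> omega

end sig

theorem row_unique {h : ℕ} {lam : BPartition} (hs : IsHStrict h lam) {a b : ℕ}
    (he : lam.parts a = lam.parts b) (hd : ¬ h ∣ lam.parts a) : a = b := by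
  rcases lt_trichotomy a b with h1 | h1 | h1
  · have := hstrict_lt hs h1 hd; omega
  · exact h1
  · have := hstrict_lt hs h1 (by rw [← he]; exact hd); omega

theorem add_node {h i : ℕ} (P : Par h i) {lam : BPartition} (hs : IsHStrict h lam) {r : ℕ} {k : ℤ}
    (hr : lam.parts r + 1 = col h i k) (hk : run h i lam k ∧ ¬ run h (i+1) lam k) :
    ∃ mu, IsHStrict h mu ∧ (∀ s, mu.parts s = lam.parts s + if s = r then 1 else 0) ∧
      Rest h i lam mu ∧ (∀ j, run h i mu j ↔ run h i lam j ∧ j ≠ k) ∧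
      (∀ j, run h (i+1) mu j ↔ run h (i+1) lam j ∨ j = k) ∧
      diagram mu = diagram lam ∪ {(r, col h i k)} := by
  obtain ⟨a1, a2⟩ := (run_iff P).1.mp hk
  have hnd := col_ndvd P k
  have hc2 := col_pos P k
  obtain ⟨mu, m1, m2, m3⟩ := move_part hs (r := r) (q := col h i k - 1) (p := col h i k)
    (by omega) hnd.2 hnd.1 (by omega) a2
  have Q1 : Q i i := Or.inl rfl
  have Q2 : Q i (i+1) := Or.inr rfl
  have hf : Flip2 lam mu (k * h + (i:ℕ)).natAbs (k * h + ((i + 1 : ℕ) : ℤ)).natAbs := by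
    rcases col_spec P k with ⟨_, _, c, d, -⟩ | ⟨_, _, c, d, -⟩
    · rw [← c, show (k * h + (i:ℕ)).natAbs = col h i k - 1 by omega]; exact m3
    · rw [← c, show (k * h + ((i + 1 : ℕ) : ℤ)).natAbs = col h i k - 1 by omega]
      exact flip_comm m3
  obtain ⟨hR, hrun⟩ := flip_run P Q1 Q2 hf
  refine ⟨mu, m1, ?_, hR, ?_, ?_, ?_⟩
  · intro s; rw [m2]; split_ifs with e
    · subst e; omega
    · rfl
  · intro j
    rw [hrun i Q1 j]
    by_cases e : j = k
    · subst e; simp [hk.1]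
    · simp [e]
  · intro j
    rw [hrun (i+1) Q2 j]
    by_cases e : j = k
    · subst e; simp [hk.2]
    · simp [e]
  · ext ⟨s, d⟩
    simp only [diagram, Set.mem_ofPred_eq, Set.mem_union, Set.mem_singleton_iff, m2, Prod.mk.injEq]
    split_ifs with e
    · subst e; omega
    · simp [e]

theorem exists_row {h i : ℕ} (P : Par h i) {lam : BPartition} {k : ℤ}
    (hk : run h i lam k ∧ ¬ run h (i+1) lam k) : ∃ r, lam.parts r + 1 = col h i k := by
  obtain ⟨a1, a2⟩ := (run_iff P).1.mp hk
  have hc2 := col_pos P k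
  obtain ⟨-, r, hr⟩ := mem_partsM.mp a1
  exact ⟨r, by omega⟩

theorem exists_row' {h i : ℕ} (P : Par h i) {lam : BPartition} {k : ℤ}
    (hk : run h (i+1) lam k ∧ ¬ run h i lam k) : ∃ r, lam.parts r = col h i k := by
  obtain ⟨a1, a2⟩ := (run_iff P).2.mp hk
  obtain ⟨-, r, hr⟩ := mem_partsM.mp a1
  exact ⟨r, hr⟩

theorem ex_addable {h i : ℕ} (P : Par h i) {lam : BPartition} (hs : IsHStrict h lam) :
    (∃ x, Addable h i lam x) ↔ ∃ k, run h i lam k ∧ ¬ run h (i+1) lam k := by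
  constructor
  · rintro ⟨x, hx⟩
    obtain ⟨k, -, -, hk⟩ := (addable_iff P hs).mp hx
    exact ⟨k, hk⟩
  · rintro ⟨k, hk⟩
    obtain ⟨r, hr⟩ := exists_row P hk
    exact ⟨(r, col h i k), (addable_iff P hs).mpr ⟨k, rfl, hr, hk⟩⟩

theorem ex_removable {h i : ℕ} (P : Par h i) {lam : BPartition} (hs : IsHStrict h lam) :
    (∃ x, Removable h i lam x) ↔ ∃ k, run h (i+1) lam k ∧ ¬ run h i lam k := by
  constructor
  · rintro ⟨x, hx⟩
    obtain ⟨k, -, -, hk⟩ := (removable_iff P hs).mp hx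
    exact ⟨k, hk⟩
  · rintro ⟨k, hk⟩
    obtain ⟨r, hr⟩ := exists_row' P hk
    exact ⟨(r, col h i k), (removable_iff P hs).mpr ⟨k, rfl, hr, hk⟩⟩

theorem addable_eq {h i : ℕ} (P : Par h i) {lam : BPartition} (hs : IsHStrict h lam) {k : ℤ}
    {r : ℕ} (hr : lam.parts r + 1 = col h i k) {x : ℕ × ℕ} :
    (x.2 = col h i k ∧ lam.parts x.1 + 1 = col h i k) ↔ x = (r, col h i k) := by
  constructor
  · rintro ⟨a, b⟩
    refine Prod.ext (row_unique hs (by change lam.parts x.1 = lam.parts r; omega) ?_) a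
    rw [show lam.parts x.1 = col h i k - 1 by omega]
    exact (col_ndvd P k).2
  · rintro rfl; exact ⟨rfl, hr⟩

theorem removable_eq {h i : ℕ} (P : Par h i) {lam : BPartition} (hs : IsHStrict h lam) {k : ℤ}
    {r : ℕ} (hr : lam.parts r = col h i k) {x : ℕ × ℕ} :
    (x.2 = col h i k ∧ lam.parts x.1 = col h i k) ↔ x = (r, col h i k) := by
  constructor
  · rintro ⟨a, b⟩
    refine Prod.ext (row_unique hs (by change lam.parts x.1 = lam.parts r; omega) ?_) a
    rw [b]
    exact (col_ndvd P k).1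
  · rintro rfl; exact ⟨rfl, hr⟩

theorem addable_two {h i : ℕ} (P : Par h i) {lam : BPartition} (hs : IsHStrict h lam) {k l : ℤ}
    {r s : ℕ} (hr : lam.parts r + 1 = col h i k) (hs' : lam.parts s + 1 = col h i l)
    (hrun : ∀ j, (run h i lam j ∧ ¬ run h (i+1) lam j) ↔ j = k ∨ j = l) (x : ℕ × ℕ) :
    Addable h i lam x ↔ x = (r, col h i k) ∨ x = (s, col h i l) := by
  rw [addable_iff P hs, ← addable_eq P hs hr, ← addable_eq P hs hs']
  simp only [hrun]
  constructor
  · rintro ⟨j, a, b, rfl | rfl⟩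
    · exact Or.inl ⟨a, b⟩
    · exact Or.inr ⟨a, b⟩
  · rintro (⟨a, b⟩ | ⟨a, b⟩)
    · exact ⟨k, a, b, Or.inl rfl⟩
    · exact ⟨l, a, b, Or.inr rfl⟩

theorem removable_one {h i : ℕ} (P : Par h i) {lam : BPartition} (hs : IsHStrict h lam) {k : ℤ}
    {r : ℕ} (hr : lam.parts r = col h i k)
    (hrun : ∀ j, (run h (i+1) lam j ∧ ¬ run h i lam j) ↔ j = k) (x : ℕ × ℕ) :
    Removable h i lam x ↔ x = (r, col h i k) := by
  rw [removable_iff P hs, ← removable_eq P hs hr]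
  simp only [hrun]
  constructor
  · rintro ⟨j, a, b, rfl⟩
    exact ⟨a, b⟩
  · rintro ⟨a, b⟩
    exact ⟨k, a, b, rfl⟩

theorem dom_of {f : ℕ → ℕ} {lam mu : BPartition} {r s : ℕ} (hrs : r < s)
    (hl : ∀ t, lam.parts t = f t + if t = s then 1 else 0)
    (hm : ∀ t, mu.parts t = f t + if t = r then 1 else 0) : domLT lam mu := by
  constructor
  · intro R
    simp only [hl, hm, Finset.sum_add_distrib, Finset.sum_ite_eq', Finset.mem_range]
    split_ifs <;> omega
  · rintro rfl
    have h1 := hl r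
    have h2 := hm r
    rw [if_neg (by omega)] at h1
    rw [if_pos rfl] at h2
    omega

/-- three integers sorted by column -/
theorem sort3 {h i : ℕ} (P : Par h i) (b : ℤ) : ∃ j1 j2 j3 : ℤ,
    col h i j1 < col h i j2 ∧ col h i j2 < col h i j3 ∧
    (∀ j, (b - 1 ≤ j ∧ j ≤ b + 1) ↔ (j = j1 ∨ j = j2 ∨ j = j3)) ∧
    j1 ≠ j2 ∧ j1 ≠ j3 ∧ j2 ≠ j3 := by
  have a1 : col h i (b-1) ≠ col h i b := fun e => by have := col_inj P e; omega
  have a2 : col h i (b-1) ≠ col h i (b+1) := fun e => by have := col_inj P e; omega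
  have a3 : col h i b ≠ col h i (b+1) := fun e => by have := col_inj P e; omega
  rcases lt_or_gt_of_ne a1 with c1 | c1 <;> rcases lt_or_gt_of_ne a2 with c2 | c2 <;>
    rcases lt_or_gt_of_ne a3 with c3 | c3
  · exact ⟨b-1, b, b+1, c1, c3, fun j => by omega, by omega, by omega, by omega⟩
  · exact ⟨b-1, b+1, b, c2, c3, fun j => by omega, by omega, by omega, by omega⟩
  · omega
  · exact ⟨b+1, b-1, b, c2, c1, fun j => by omega, by omega, by omega, by omega⟩
  · exact ⟨b, b-1, b+1, c1, c2, fun j => by omega, by omega, by omega, by omega⟩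
  · omega
  · exact ⟨b, b+1, b-1, c3, c2, fun j => by omega, by omega, by omega, by omega⟩
  · exact ⟨b+1, b, b-1, c3, c1, fun j => by omega, by omega, by omega, by omega⟩

end BPartition
namespace BPartition

theorem exc_unique {h i : ℕ} (P : Par h i) {σ lam mu : BPartition} {q q' : ℕ}
    (hqq : (q = i ∧ q' = i + 1) ∨ (q = i + 1 ∧ q' = i)) {b j : ℤ}
    (hl : IsHStrict h lam) (hm : IsHStrict h mu) (rl : Rest h i σ lam) (rm : Rest h i σ mu)
    (el : Exc h q q' b j lam) (em : Exc h q q' b j mu) : lam = mu := by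
  apply eq_of_run P hl hm (rl.symm.trans rm)
  intro p hp k
  have : p = q ∨ p = q' := by unfold Q at hp; omega
  rcases this with rfl | rfl
  · rw [em.1, el.1]
  · rw [em.2, el.2]

theorem block_set {h i : ℕ} (P : Par h i) {σ F1 F2 F3 : BPartition} (hσ : IsBarCore h σ)
    {q q' : ℕ} (hqq : (q = i ∧ q' = i + 1) ∨ (q = i + 1 ∧ q' = i)) {b j1 j2 j3 : ℤ}
    (hA : ∀ k, run h q σ k ↔ k ≤ b) (hB : ∀ k, run h q' σ k ↔ k < b)
    (hj : ∀ j, (b - 1 ≤ j ∧ j ≤ b + 1) ↔ (j = j1 ∨ j = j2 ∨ j = j3))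
    (h1 : IsHStrict h F1) (h2 : IsHStrict h F2) (h3 : IsHStrict h F3)
    (r1 : Rest h i σ F1) (r2 : Rest h i σ F2) (r3 : Rest h i σ F3)
    (e1 : Exc h q q' b j1 F1) (e2 : Exc h q q' b j2 F2) (e3 : Exc h q q' b j3 F3)
    (lam : BPartition) :
    (InBlock h σ 2 lam ∧ ∃ k, run h q' lam k ∧ ¬ run h q lam k) ↔
      (lam = F1 ∨ lam = F2 ∨ lam = F3) := by
  constructor
  · rintro ⟨hb, hex⟩
    obtain ⟨hs, hr, j, ja, jb, he⟩ := block_forward P hqq hA hB hb hex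
    rcases (hj j).mp ⟨ja, jb⟩ with rfl | rfl | rfl
    · exact Or.inl (exc_unique P hqq hs h1 hr r1 he e1)
    · exact Or.inr (Or.inl (exc_unique P hqq hs h2 hr r2 he e2))
    · exact Or.inr (Or.inr (exc_unique P hqq hs h3 hr r3 he e3))
  · rintro (rfl | rfl | rfl)
    · have := (hj j1).mpr (by simp)
      obtain ⟨a, c⟩ := block_backward P hσ hqq hA hB h1 r1 this.1 this.2 e1
      exact ⟨a, j1, c⟩
    · have := (hj j2).mpr (by simp)
      obtain ⟨a, c⟩ := block_backward P hσ hqq hA hB h2 r2 this.1 this.2 e2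
      exact ⟨a, j2, c⟩
    · have := (hj j3).mpr (by simp)
      obtain ⟨a, c⟩ := block_backward P hσ hqq hA hB h3 r3 this.1 this.2 e3
      exact ⟨a, j3, c⟩

theorem down {A : ℤ → Prop} (hd : ∀ k, A k → A (k - 1)) {b : ℤ} (hb : A b) {k : ℤ} (hk : k ≤ b) :
    A k := by
  induction k, hk using Int.le_induction_down with
  | base => exact hb
  | pred n _ ih => exact hd n ih

theorem core_shape {h i : ℕ} (P : Par h i) {σ : BPartition} (hσ : IsBarCore h σ)
    (hcnt : Set.ncard {x : ℕ × ℕ | Addable h i σ x} = 1) :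
    ∃ b : ℤ, (∀ k, run h i σ k ↔ k ≤ b) ∧ (∀ k, run h (i+1) σ k ↔ k < b) := by
  obtain ⟨x0, hx0⟩ := Set.ncard_eq_one.mp hcnt
  have hx : ∀ x, Addable h i σ x ↔ x = x0 := by
    intro x
    have : x ∈ {x : ℕ × ℕ | Addable h i σ x} ↔ x ∈ ({x0} : Set (ℕ × ℕ)) := by rw [hx0]
    simpa using this
  obtain ⟨b, hb1, hb2, hb3, hb4⟩ := (addable_iff P hσ.1).mp ((hx x0).mpr rfl)
  have hun : ∀ k, run h i σ k → ¬ run h (i+1) σ k → k = b := by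
    intro k k1 k2
    obtain ⟨r, hr⟩ := exists_row P ⟨k1, k2⟩
    have : (r, col h i k) = x0 := (hx _).mp ((addable_iff P hσ.1).mpr ⟨k, rfl, hr, k1, k2⟩)
    rw [← this] at hb1
    exact col_inj P hb1
  have Q1 : Q i i := Or.inl rfl
  have Q2 : Q i (i+1) := Or.inr rfl
  have dA : ∀ k, run h i σ k → run h i σ (k-1) := fun k => core_run P hσ Q1
  have dB : ∀ k, run h (i+1) σ k → run h (i+1) σ (k-1) := fun k => core_run P hσ Q2
  have nB : ∀ k, b ≤ k → ¬ run h (i+1) σ k := fun k hk hc => hb4 (down dB hc hk)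
  refine ⟨b, fun k => ⟨fun hk => ?_, fun hk => down dA hb3 hk⟩,
    fun k => ⟨fun hk => ?_, fun hk => ?_⟩⟩
  · by_contra hc
    have := hun k hk (nB k (by omega)); omega
  · by_contra hc
    exact nB k (by omega) hk
  · by_contra hc
    have := hun k (down dA hb3 hk.le) hc; omega

end BPartition

open BPartition in
/-- In a [2:1]-pair of residue i with 1 ≤ i < n: there are exactly three
exceptional partitions α ◁ β ◁ γ in P_{σ,2} and exactly three exceptional
partitions α̂ ◁ β̂ ◁ γ̂ in P_{τ,2}, and ψ_i(α) = α̂, ψ_i(β) = γ̂, ψ_i(γ) = β̂. -/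
theorem stmt17 (n h : ℕ) (hn : 2 ≤ n) (hh : h = 2 * n + 1) (i : ℕ)
    (hi1 : 1 ≤ i) (hi2 : i < n)
    (σ : BPartition) (hσ : IsBarCore h σ)
    (hcnt : Set.ncard {x : ℕ × ℕ | Addable h i σ x} = 1)
    (τ : BPartition) (hτ : τ = psi h i σ) :
    ∃ α β γ α' β' γ' : BPartition,
      {lam | InBlock h σ 2 lam ∧ ∃ x, Removable h i lam x} = {α, β, γ} ∧
      domLT α β ∧ domLT β γ ∧
      {mu | InBlock h τ 2 mu ∧ ∃ x, Addable h i mu x} = {α', β', γ'} ∧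
      domLT α' β' ∧ domLT β' γ' ∧
      psi h i α = α' ∧ psi h i β = γ' ∧ psi h i γ = β' := by
  have P : Par h i := ⟨by omega, hi1, by omega⟩
  have Q1 : Q i i := Or.inl rfl
  have Q2 : Q i (i+1) := Or.inr rfl
  obtain ⟨b, hA, hB⟩ := core_shape P hσ hcnt
  -- the core τ
  have hb : run h i σ b ∧ ¬ run h (i+1) σ b := by rw [hA, hB]; omega
  obtain ⟨r0, hr0⟩ := exists_row P hb
  obtain ⟨τ', t1, t2, t3, t4, t5, t6⟩ := add_node P hσ.1 hr0 hb
  have hτ' : psi h i σ = τ' := by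
    apply psi_eq
    rw [t6, sig0]
    · intro x
      rw [addable_two P hσ.1 hr0 hr0 (fun j => by rw [hA, hB]; omega)]
      simp
    · intro x
      rw [iff_false]
      intro hx
      obtain ⟨k, hk1, hk2⟩ := (ex_removable P hσ.1).mp ⟨x, hx⟩
      rw [hB] at hk1; rw [hA] at hk2; omega
  rw [hτ'] at hτ
  subst hτ
  have hA' : ∀ k, run h i τ k ↔ k < b := by intro k; rw [t4, hA]; omega
  have hB' : ∀ k, run h (i+1) τ k ↔ k ≤ b := by intro k; rw [t5, hB]; omega
  have hτc : IsBarCore h τ := by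
    apply core_of_rest P hσ t1 t3
    rintro q (rfl | rfl) k
    · rw [hA', hA']; omega
    · rw [hB', hB']; omega
  -- the base
  obtain ⟨B, b1, b2⟩ := exists_flip2 hσ.1 (pos_ndvd' P Q1 (b+1)) (pos_ndvd' P Q2 (b-1))
  obtain ⟨bR, brun⟩ := flip_run P Q1 Q2 b2
  have bA : ∀ k, run h i B k ↔ k ≤ b + 1 := by
    intro k; rw [brun i Q1, hA]; omega
  have bB : ∀ k, run h (i+1) B k ↔ k < b - 1 := by
    intro k; rw [brun (i+1) Q2, hB]; omega
  obtain ⟨j1, j2, j3, c12, c23, hj, n12, n13, n23⟩ := sort3 P b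
  have hin : ∀ j, (j = j1 ∨ j = j2 ∨ j = j3) → run h i B j ∧ ¬ run h (i+1) B j := by
    intro j h0
    have := (hj j).mpr h0
    rw [bA, bB]; omega
  have k1 := (hj j1).mpr (by simp)
  have k2 := (hj j2).mpr (by simp)
  have k3 := (hj j3).mpr (by simp)
  obtain ⟨r1, hr1⟩ := exists_row P (hin j1 (by simp))
  obtain ⟨r2, hr2⟩ := exists_row P (hin j2 (by simp))
  obtain ⟨r3, hr3⟩ := exists_row P (hin j3 (by simp))
  have h21 : r2 < r1 := by
    by_contra hc
    have := anti (lam := B) (not_lt.mp hc); omega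
  have h32 : r3 < r2 := by
    by_contra hc
    have := anti (lam := B) (not_lt.mp hc); omega
  obtain ⟨F1, f1s, f1p, f1R, f1A, f1B, f1d⟩ := add_node P b1 hr1 (hin j1 (by simp))
  obtain ⟨F2, f2s, f2p, f2R, f2A, f2B, f2d⟩ := add_node P b1 hr2 (hin j2 (by simp))
  obtain ⟨F3, f3s, f3p, f3R, f3A, f3B, f3d⟩ := add_node P b1 hr3 (hin j3 (by simp))
  simp only [bA] at f1A f2A f3A
  simp only [bB] at f1B f2B f3B
  -- parts of the F
  have p11 : F1.parts r1 = col h i j1 := by rw [f1p, if_pos rfl, hr1]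
  have p12 : F1.parts r2 + 1 = col h i j2 := by rw [f1p, if_neg (by omega)]; exact hr2
  have p13 : F1.parts r3 + 1 = col h i j3 := by rw [f1p, if_neg (by omega)]; exact hr3
  have p21 : F2.parts r1 + 1 = col h i j1 := by rw [f2p, if_neg (by omega)]; exact hr1
  have p22 : F2.parts r2 = col h i j2 := by rw [f2p, if_pos rfl, hr2]
  have p23 : F2.parts r3 + 1 = col h i j3 := by rw [f2p, if_neg (by omega)]; exact hr3
  have p31 : F3.parts r1 + 1 = col h i j1 := by rw [f3p, if_neg (by omega)]; exact hr1
  have p32 : F3.parts r2 + 1 = col h i j2 := by rw [f3p, if_neg (by omega)]; exact hr2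
  have p33 : F3.parts r3 = col h i j3 := by rw [f3p, if_pos rfl, hr3]
  -- the G
  obtain ⟨G3, g3s, g3p, g3R, g3A, g3B, g3d⟩ := add_node P f1s p12 (by rw [f1A, f1B]; omega)
  obtain ⟨G1, g1s, g1p, g1R, g1A, g1B, g1d⟩ := add_node P f2s p23 (by rw [f2A, f2B]; omega)
  obtain ⟨G2, g2s, g2p, g2R, g2A, g2B, g2d⟩ := add_node P f3s p31 (by rw [f3A, f3B]; omega)
  have tR : Rest h i τ B := t3.symm.trans bR
  refine ⟨F1, F2, F3, G3, G2, G1, ?_, ?_, ?_, ?_, ?_, ?_, ?_, ?_, ?_⟩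
  · ext lam
    have := block_set P hσ (Or.inl ⟨rfl, rfl⟩) hA hB hj f1s f2s f3s (bR.trans f1R) (bR.trans f2R)
      (bR.trans f3R) ⟨f1A, f1B⟩ ⟨f2A, f2B⟩ ⟨f3A, f3B⟩ lam
    simp only [Set.mem_ofPred_eq, Set.mem_insert_iff, Set.mem_singleton_iff]
    rw [← this]
    constructor
    · rintro ⟨a, c⟩; exact ⟨a, (ex_removable P a.1).mp c⟩
    · rintro ⟨a, c⟩; exact ⟨a, (ex_removable P a.1).mpr c⟩
  · exact dom_of h21 f1p f2p
  · exact dom_of h32 f2p f3p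
  · ext lam
    have := block_set P hτc (Or.inr ⟨rfl, rfl⟩) hB' hA'
      (j1 := j3) (j2 := j2) (j3 := j1) (fun j => by rw [hj]; tauto) g3s g2s g1s
      (tR.trans (f1R.trans g3R)) (tR.trans (f3R.trans g2R)) (tR.trans (f2R.trans g1R))
      ⟨fun k => by have := hj k; rw [g3B, f1B]; omega, fun k => by have := hj k; rw [g3A, f1A]; omega⟩
      ⟨fun k => by have := hj k; rw [g2B, f3B]; omega, fun k => by have := hj k; rw [g2A, f3A]; omega⟩
      ⟨fun k => by have := hj k; rw [g1B, f2B]; omega, fun k => by have := hj k; rw [g1A, f2A]; omega⟩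
      lam
    simp only [Set.mem_ofPred_eq, Set.mem_insert_iff, Set.mem_singleton_iff]
    rw [← this]
    constructor
    · rintro ⟨a, c⟩; exact ⟨a, (ex_addable P a.1).mp c⟩
    · rintro ⟨a, c⟩; exact ⟨a, (ex_addable P a.1).mpr c⟩
  · refine dom_of (f := fun t => B.parts t + if t = r1 then 1 else 0) h32 ?_ ?_
    · intro t; rw [g3p, f1p]
    · intro t; rw [g2p, f3p]; omega
  · refine dom_of (f := fun t => B.parts t + if t = r3 then 1 else 0) h21 ?_ ?_
    · intro t; rw [g2p, f3p]
    · intro t; rw [g1p, f2p]; omega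
  · apply psi_eq
    rw [g3d, sig1 (x1 := (r1, col h i j1)) (x2 := (r2, col h i j2)) (x3 := (r3, col h i j3)) c12 c23]
    · exact addable_two P f1s p12 p13 (fun j => by have := hj j; rw [f1A, f1B]; omega)
    · exact removable_one P f1s p11 (fun j => by have := hj j; rw [f1A, f1B]; omega)
  · apply psi_eq
    rw [g1d, sig2 (x1 := (r1, col h i j1)) (x2 := (r2, col h i j2)) (x3 := (r3, col h i j3)) c12 c23]
    · exact addable_two P f2s p21 p23 (fun j => by have := hj j; rw [f2A, f2B]; omega)
    · exact removable_one P f2s p22 (fun j => by have := hj j; rw [f2A, f2B]; omega)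
  · apply psi_eq
    rw [g2d, sig3 (x1 := (r1, col h i j1)) (x2 := (r2, col h i j2)) (x3 := (r3, col h i j3)) c12 c23]
    · exact addable_two P f3s p31 p32 (fun j => by have := hj j; rw [f3A, f3B]; omega)
    · exact removable_one P f3s p33 (fun j => by have := hj j; rw [f3A, f3B]; omega)
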